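/- Let k, h ≥ 4 be integers, and set a := 3^{k−1}, b := 3^{h−1}. Define C_k := B_{3^k}(2a) ∖ {(2a, a−1, 1), (2a, 2, 1^{a−2}), (2a−1, a+1), (2a−1, 1^{a+1})}° and define C_h analogously with b in place of a. Then C_k ⋆ C_h = B_{3^k + 3^h}(2a + 2b). -/

import Mathlib

open scoped Classical

namespace SylowBranching

/-- The cells of the Young diagram of `f` (rows indexed by the first coordinate,
starting from `0`; `f i` is the length of row `i`). -/
def cellsOf (f : ℕ → ℕ) : Set (ℕ × ℕ) := {p | p.2 < f p.1}

/-- `f : ℕ → ℕ` is a partition if it is weakly decreasing with finitely many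
nonzero parts.  Its parts are `f 0 ≥ f 1 ≥ ⋯`, and its largest part is `f 0`. -/
def IsPartition (f : ℕ → ℕ) : Prop :=
  Antitone f ∧ ∃ N, ∀ i, N ≤ i → f i = 0

/-- The size `|f|` of a partition: the number of cells of its Young diagram. -/
noncomputable def psize (f : ℕ → ℕ) : ℕ := (cellsOf f).ncard

/-- `P(n)`: the set of partitions of `n`. -/
def Pset (n : ℕ) : Set (ℕ → ℕ) := {f | IsPartition f ∧ psize f = n}

/-- The conjugate (transpose) partition `f'`. -/
noncomputable def conj (f : ℕ → ℕ) : ℕ → ℕ := fun j => Set.ncard {i | j < f i}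

/-- `A° = A ∪ A'`: the closure of a set of partitions under conjugation. -/
noncomputable def conjClosure (A : Set (ℕ → ℕ)) : Set (ℕ → ℕ) := A ∪ conj '' A

/-- `B_n(t)`: partitions of `n` with largest part at most `t` and at most `t` parts. -/
noncomputable def Bset (n t : ℕ) : Set (ℕ → ℕ) :=
  {f ∈ Pset n | f 0 ≤ t ∧ conj f 0 ≤ t}

/-- The cells of the skew shape `l / m`. -/
def skewCells (l m : ℕ → ℕ) : Set (ℕ × ℕ) :=
  {p | m p.1 ≤ p.2 ∧ p.2 < l p.1}

/-- `d` is read before (or at the same time as) `c` in the reading order of a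
filling: right-to-left along rows, rows from top to bottom. -/
def readBefore (d c : ℕ × ℕ) : Prop :=
  d.1 < c.1 ∨ (d.1 = c.1 ∧ c.2 ≤ d.2)

/-- A Littlewood–Richardson filling of the cell set `γ` of weight `ν`:
all entries are positive; for every `j ≥ 1` there are exactly `ν (j-1)` entries
equal to `j` (i.e. the number of `j`s is the `j`-th part of `ν`); entries weakly
increase along rows and strictly increase down columns; and every initial
segment of the reading word (right-to-left along rows, top to bottom) contains
at least as many entries equal to `j` as entries equal to `j+1`, for all `j ≥ 1`. -/
structure IsLRFilling (γ : Set (ℕ × ℕ)) (ν : ℕ → ℕ) (T : ℕ × ℕ → ℕ) : Prop where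
  pos : ∀ c ∈ γ, 1 ≤ T c
  weight : ∀ j : ℕ, 1 ≤ j → Set.ncard {c ∈ γ | T c = j} = ν (j - 1)
  row_weak : ∀ i j j', (i, j) ∈ γ → (i, j') ∈ γ → j ≤ j' → T (i, j) ≤ T (i, j')
  col_strict : ∀ i i' j, (i, j) ∈ γ → (i', j) ∈ γ → i < i' → T (i, j) < T (i', j)
  lattice : ∀ c ∈ γ, ∀ j : ℕ, 1 ≤ j →
    Set.ncard {d ∈ γ | T d = j + 1 ∧ readBefore d c} ≤
      Set.ncard {d ∈ γ | T d = j ∧ readBefore d c}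

/-- `LR(γ)`: the set of all weights of LR fillings of `γ`. -/
def LRset (γ : Set (ℕ × ℕ)) : Set (ℕ → ℕ) := {ν | ∃ T, IsLRFilling γ ν T}

/-- The Littlewood–Richardson coefficient `c^l_{m ν}`: the number of LR fillings
of the skew shape `l / m` of weight `ν` (zero unless `m ⊆ l`); fillings are
normalised to vanish off the skew shape so that they can be counted. -/
noncomputable def LRcoeff (l m ν : ℕ → ℕ) : ℕ :=
  Set.ncard {T : ℕ × ℕ → ℕ |
    (∀ i, m i ≤ l i) ∧ (∀ c, c ∉ skewCells l m → T c = 0) ∧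
      IsLRFilling (skewCells l m) ν T}

/-- The `⋆` operation on sets of partitions:
`A ⋆ B = {λ : c^λ_{μν} > 0 for some μ ∈ A, ν ∈ B}`. -/
def starOp (A B : Set (ℕ → ℕ)) : Set (ℕ → ℕ) :=
  {l | IsPartition l ∧ ∃ μ ∈ A, ∃ ν ∈ B, 0 < LRcoeff l μ ν}

/-- The partition with the given (weakly decreasing) list of parts. -/
def ofList (L : List ℕ) : ℕ → ℕ := fun i => L.getD i 0

/-- The hook partition `(a, 1^b)`. -/
def hookP (a b : ℕ) : ℕ → ℕ := ofList (a :: List.replicate b 1)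

/-- The partition `(a, μ)` obtained by prepending a first part `a` to `μ`. -/
def consPart (a : ℕ) (μ : ℕ → ℕ) : ℕ → ℕ := fun i => if i = 0 then a else μ (i - 1)

/-- `γ` coincides, up to planar translation, with the Young diagram of `ν`. -/
def TranslateOf (γ : Set (ℕ × ℕ)) (ν : ℕ → ℕ) : Prop :=
  ∃ a b : ℕ, γ = (fun p : ℕ × ℕ => (p.1 + a, p.2 + b)) '' cellsOf ν

/-- `γ` coincides, up to planar translation, with the 180°-rotation of the
Young diagram of `ν`. -/
def RotationOf (γ : Set (ℕ × ℕ)) (ν : ℕ → ℕ) : Prop :=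
  ∃ a b : ℕ, (∀ p ∈ cellsOf ν, p.1 ≤ a ∧ p.2 ≤ b) ∧
    γ = (fun p : ℕ × ℕ => (a - p.1, b - p.2)) '' cellsOf ν

/-- Iterated Littlewood–Richardson coefficients `c^l_{μ^1, …, μ^r}`:
`c^l_{μ} = δ_{l μ}`, and the coefficient for a longer list is obtained by
summing, over partitions `g` of the total size of the remaining factors, the
product of the iterated coefficient of `g` with `c^l_{g μ}`. -/
noncomputable def iterLR : List (ℕ → ℕ) → (ℕ → ℕ) → ℕ
  | [], l => if l = (fun _ => 0 : ℕ → ℕ) then 1 else 0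
  | [μ], l => if l = μ then 1 else 0
  | μ :: μs, l =>
      ∑' g : {g : ℕ → ℕ // IsPartition g ∧ psize g = (μs.map psize).sum},
        iterLR μs g.1 * LRcoeff l g.1 μ

/-- `D(q, m, B)`: partitions `λ` of `qm` with `c^λ_{μ_1, …, μ_q} > 0` for some
`μ_1, …, μ_q ∈ B` that are not all equal. -/
noncomputable def Dset (q m : ℕ) (B : Set (ℕ → ℕ)) : Set (ℕ → ℕ) :=
  {l ∈ Pset (q * m) | ∃ μ : Fin q → (ℕ → ℕ),
    (∀ i, μ i ∈ B) ∧ (∃ i j, μ i ≠ μ j) ∧ 0 < iterLR (List.ofFn μ) l}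

/-- Iterated `⋆` of a list of sets of partitions. -/
def starAll : List (Set (ℕ → ℕ)) → Set (ℕ → ℕ)
  | [] => Pset 0
  | [A] => A
  | A :: B :: rest => starOp A (starAll (B :: rest))

/-- `Ω(φ(1,0,…,0))` for the Sylow 3-subgroup of `S_{3^k}` (`k ≥ 4`):
`B_{3^k}(2a) ∖ {(2a, a−1, 1), (2a, 2, 1^{a−2}), (2a−1, a+1), (2a−1, 1^{a+1})}°`
where `a = 3^{k−1}`. -/
noncomputable def Cset (k : ℕ) : Set (ℕ → ℕ) :=
  Bset (3 ^ k) (2 * 3 ^ (k - 1)) \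
    conjClosure
      {ofList [2 * 3 ^ (k - 1), 3 ^ (k - 1) - 1, 1],
       ofList (2 * 3 ^ (k - 1) :: 2 :: List.replicate (3 ^ (k - 1) - 2) 1),
       ofList [2 * 3 ^ (k - 1) - 1, 3 ^ (k - 1) + 1],
       hookP (2 * 3 ^ (k - 1) - 1) (3 ^ (k - 1) + 1)}

/-! ### Partitions and conjugation -/

section Partitions

variable {f : ℕ → ℕ}

theorem IsPartition.setOf_lt_eq_Iio (hf : IsPartition f) (j : ℕ) :
    ∃ n, {i | j < f i} = Set.Iio n := by
  obtain ⟨hanti, N, hN⟩ := hf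
  have hex : ∃ i, f i ≤ j := ⟨N, by simp [hN N le_rfl]⟩
  refine ⟨Nat.find hex, Set.ext fun i => ?_⟩
  simp only [Set.mem_ofPred_eq, Set.mem_Iio, Nat.lt_find_iff, not_le]
  exact ⟨fun h m hm => h.trans_le (hanti hm), fun h => h i le_rfl⟩

theorem IsPartition.lt_conj_iff (hf : IsPartition f) {i j : ℕ} : i < conj f j ↔ j < f i := by
  obtain ⟨n, hn⟩ := hf.setOf_lt_eq_Iio j
  have hmem : i ∈ {i | j < f i} ↔ i ∈ Set.Iio n := by rw [hn]
  have hcard : conj f j = n := by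
    rw [conj, hn, ← Finset.coe_Iio, Set.ncard_coe_finset, Nat.card_Iio]
  rw [hcard]
  exact hmem.symm

theorem IsPartition.conj_le_iff (hf : IsPartition f) {i j : ℕ} : conj f j ≤ i ↔ f i ≤ j := by
  simpa using not_congr (hf.lt_conj_iff (i := i) (j := j))

theorem IsPartition.isPartition_conj (hf : IsPartition f) : IsPartition (conj f) := by
  refine ⟨fun j j' hjj' => ?_, f 0, fun j hj => ?_⟩
  · rw [hf.conj_le_iff]
    exact ((hf.conj_le_iff).1 le_rfl).trans hjj'
  · exact Nat.le_zero.1 (hf.conj_le_iff.2 hj)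

theorem IsPartition.conj_conj (hf : IsPartition f) : conj (conj f) = f := by
  funext i
  refine eq_of_forall_lt_iff fun j => ?_
  rw [hf.isPartition_conj.lt_conj_iff, hf.lt_conj_iff]

theorem cellsOf_eq_coe {N : ℕ} (hN : ∀ i, N ≤ i → f i = 0) :
    cellsOf f = ((Finset.range N).sigma fun i => Finset.range (f i)).map
      (Equiv.sigmaEquivProd ℕ ℕ).toEmbedding := by
  ext ⟨i, j⟩
  simp only [cellsOf, Set.mem_ofPred_eq, Finset.coe_map, Set.mem_image, Finset.mem_coe,
    Finset.mem_sigma, Finset.mem_range, Equiv.coe_toEmbedding, Equiv.sigmaEquivProd_apply]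
  constructor
  · intro h
    refine ⟨⟨i, j⟩, ⟨?_, h⟩, rfl⟩
    by_contra hi
    simp [hN i (not_lt.1 hi)] at h
  · rintro ⟨⟨i', j'⟩, ⟨-, h⟩, heq⟩
    simp only [Prod.mk.injEq] at heq
    obtain ⟨rfl, rfl⟩ := heq
    exact h

theorem psize_eq_sum {N : ℕ} (hN : ∀ i, N ≤ i → f i = 0) :
    psize f = ∑ i ∈ Finset.range N, f i := by
  rw [psize, cellsOf_eq_coe hN, Set.ncard_coe_finset, Finset.card_map, Finset.card_sigma]
  simp

theorem IsPartition.finite_cellsOf (hf : IsPartition f) : (cellsOf f).Finite := by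
  obtain ⟨-, N, hN⟩ := hf
  rw [cellsOf_eq_coe hN]
  exact Finset.finite_toSet _

end Partitions

/-! ### Partitions presented by their columns -/

/-- The one-column partition `(1^n)`. -/
def column (n : ℕ) : ℕ → ℕ := fun i => if i < n then 1 else 0

/-- The partition whose multiset of column lengths is `x 0, …, x (w - 1)`, in any order. -/
def ofColumns (w : ℕ) (x : ℕ → ℕ) : ℕ → ℕ := fun i => ∑ j ∈ Finset.range w, column (x j) i

section Columns

variable {w : ℕ} {x : ℕ → ℕ}

theorem antitone_column (n : ℕ) : Antitone (column n) := by
  intro i j hij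
  simp only [column]
  split_ifs <;> omega

theorem isPartition_column (n : ℕ) : IsPartition (column n) :=
  ⟨antitone_column n, n, fun i hi => by simp [column, hi]⟩

theorem ofColumns_eq_zero_iff {t : ℕ} :
    ofColumns w x t = 0 ↔ ∀ j < w, x j ≤ t := by
  simp [ofColumns, column]

theorem isPartition_ofColumns (w : ℕ) (x : ℕ → ℕ) : IsPartition (ofColumns w x) := by
  refine ⟨fun i i' h => Finset.sum_le_sum fun j _ => antitone_column _ h,
    (Finset.range w).sup x, fun i hi => ofColumns_eq_zero_iff.2 fun j hj => ?_⟩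
  exact (Finset.le_sup (Finset.mem_range.2 hj)).trans hi

theorem conj_ofColumns_le_iff {t : ℕ} :
    conj (ofColumns w x) 0 ≤ t ↔ ∀ j < w, x j ≤ t := by
  rw [(isPartition_ofColumns w x).conj_le_iff, Nat.le_zero, ofColumns_eq_zero_iff]

theorem ofColumns_zero_eq : ofColumns w x 0 = ∑ j ∈ Finset.range w, min (x j) 1 := by
  refine Finset.sum_congr rfl fun j _ => ?_
  simp only [column]
  split_ifs <;> omega

theorem psize_ofColumns : psize (ofColumns w x) = ∑ j ∈ Finset.range w, x j := by
  have hN : ∀ i, (Finset.range w).sup x ≤ i → ofColumns w x i = 0 := fun i hi =>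
    ofColumns_eq_zero_iff.2 fun j hj => (Finset.le_sup (Finset.mem_range.2 hj)).trans hi
  rw [psize_eq_sum hN]
  simp only [ofColumns]
  rw [Finset.sum_comm]
  refine Finset.sum_congr rfl fun j hj => ?_
  have hle : x j ≤ (Finset.range w).sup x := Finset.le_sup hj
  simp only [column, Finset.sum_boole, Nat.cast_id]
  rw [show (Finset.range ((Finset.range w).sup x)).filter (· < x j) = Finset.range (x j) by
    ext i; simp only [Finset.mem_filter, Finset.mem_range]; omega, Finset.card_range]

theorem IsPartition.ofColumns_conj_eq {f : ℕ → ℕ} (hf : IsPartition f) :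
    ofColumns (f 0) (conj f) = f := by
  funext i
  simp only [ofColumns, column, hf.lt_conj_iff, Finset.sum_boole, Nat.cast_id]
  have hle : f i ≤ f 0 := hf.1 (Nat.zero_le i)
  rw [show (Finset.range (f 0)).filter (· < f i) = Finset.range (f i) by
    ext j; simp only [Finset.mem_filter, Finset.mem_range]; omega, Finset.card_range]

theorem ofColumns_congr {y : ℕ → ℕ} (h : ∀ j < w, x j = y j) : ofColumns w x = ofColumns w y := by
  funext i
  exact Finset.sum_congr rfl fun j hj => by rw [h j (Finset.mem_range.1 hj)]

end Columns

/-! ### Littlewood–Richardson matrices -/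

/-- `M i j` counts the entries `j + 1` in row `i` of a Littlewood–Richardson filling of `l / m`
of weight `ν`.  The defining conditions are linear, so such matrices can be added. -/
structure IsLRMatrix (l m ν : ℕ → ℕ) (M : ℕ → ℕ → ℕ) : Prop where
  row_sum : ∀ i, m i + ∑ j ∈ Finset.range (i + 1), M i j = l i
  weight : ∀ j, ∀ᶠ R in Filter.atTop, ∑ i ∈ Finset.range R, M i j = ν j
  strict : ∀ i j, m (i + 1) + ∑ t ∈ Finset.range (j + 1), M (i + 1) t ≤
    m i + ∑ t ∈ Finset.range j, M i t
  lattice : ∀ i j, ∑ r ∈ Finset.range (i + 1), M r (j + 1) ≤ ∑ r ∈ Finset.range i, M r j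

/-- Some Littlewood–Richardson matrix exists for `l`, `m`, `ν`. -/
def LRPositive (l m ν : ℕ → ℕ) : Prop := ∃ M, IsLRMatrix l m ν M

namespace IsLRMatrix

variable {l m ν : ℕ → ℕ} {M : ℕ → ℕ → ℕ}

theorem sum_eq_zero_of_lt (hM : IsLRMatrix l m ν M) :
    ∀ i j, i < j → ∑ r ∈ Finset.range (i + 1), M r j = 0 := by
  intro i
  induction i with
  | zero =>
    rintro (_ | j) hj
    · omega
    · simpa using hM.lattice 0 j
  | succ i ih =>
    rintro (_ | j) hj
    · omega
    · have := hM.lattice (i + 1) j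
      have := ih j (by omega)
      omega

theorem eq_zero_of_lt (hM : IsLRMatrix l m ν M) {i j : ℕ} (hij : i < j) : M i j = 0 :=
  (Finset.sum_eq_zero_iff.1 (hM.sum_eq_zero_of_lt i j hij)) i (by simp)

theorem bound_le (hM : IsLRMatrix l m ν M) (i t : ℕ) :
    m i + ∑ j ∈ Finset.range t, M i j ≤ l i := by
  rw [← hM.row_sum i]
  have h : ∑ j ∈ Finset.range t, M i j ≤ ∑ j ∈ Finset.range (max t (i + 1)), M i j :=
    Finset.sum_le_sum_of_subset (Finset.range_mono (le_max_left _ _))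
  have h' : ∑ j ∈ Finset.range (i + 1), M i j = ∑ j ∈ Finset.range (max t (i + 1)), M i j := by
    refine Finset.sum_subset (Finset.range_mono (le_max_right _ _)) fun j _ hj => ?_
    exact hM.eq_zero_of_lt (by simpa using hj)
  omega

theorem strict_add (hM : IsLRMatrix l m ν M) (i j k : ℕ) :
    m (i + k) + ∑ t ∈ Finset.range (j + k), M (i + k) t ≤
      m i + ∑ t ∈ Finset.range j, M i t := by
  induction k with
  | zero => simp
  | succ k ih => exact (hM.strict (i + k) (j + k)).trans ih

/-- The filling whose rows are described by `M`; it vanishes off the skew shape. -/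
noncomputable def filling (m : ℕ → ℕ) (M : ℕ → ℕ → ℕ) (c : ℕ × ℕ) : ℕ :=
  sInf {t | c.2 < m c.1 + ∑ j ∈ Finset.range t, M c.1 j}

theorem filling_eq_succ_iff {i u t : ℕ} :
    filling m M (i, u) = t + 1 ↔
      m i + ∑ j ∈ Finset.range t, M i j ≤ u ∧ u < m i + ∑ j ∈ Finset.range (t + 1), M i j := by
  have hmono : ∀ s s', s ≤ s' →
      m i + ∑ j ∈ Finset.range s, M i j ≤ m i + ∑ j ∈ Finset.range s', M i j := fun s s' h =>
    Nat.add_le_add_left (Finset.sum_le_sum_of_subset (Finset.range_mono h)) _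
  constructor
  · intro h
    have hne : {t | u < m i + ∑ j ∈ Finset.range t, M i j}.Nonempty :=
      Nat.nonempty_of_sInf_eq_succ h
    have hmem := Nat.sInf_mem hne
    have hnot : t ∉ {t | u < m i + ∑ j ∈ Finset.range t, M i j} :=
      Nat.notMem_of_lt_sInf (by change t < filling m M (i, u); omega)
    change filling m M (i, u) ∈ _ at hmem
    rw [h] at hmem
    exact ⟨not_lt.1 hnot, hmem⟩
  · rintro ⟨h1, h2⟩
    refine le_antisymm (Nat.sInf_le h2) ?_
    refine le_csInf ⟨t + 1, h2⟩ fun s (hs : u < m i + ∑ j ∈ Finset.range s, M i j) => ?_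
    by_contra hlt
    have := hmono s t (by omega)
    omega

theorem exists_filling_eq_succ (hM : IsLRMatrix l m ν M) {i u : ℕ}
    (h : (i, u) ∈ skewCells l m) : ∃ t, filling m M (i, u) = t + 1 := by
  obtain ⟨h1, h2⟩ := h
  have hmem : i + 1 ∈ {t | u < m i + ∑ j ∈ Finset.range t, M i j} := by
    change u < _
    rw [hM.row_sum]
    exact h2
  refine Nat.exists_eq_succ_of_ne_zero fun h0 => ?_
  have hin := Nat.sInf_mem ⟨_, hmem⟩
  change filling m M (i, u) ∈ _ at hin
  rw [h0] at hin
  replace hin : u < m i + ∑ j ∈ Finset.range 0, M i j := hin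
  simp at hin h1
  omega

theorem filling_eq_zero (hM : IsLRMatrix l m ν M) {c : ℕ × ℕ} (h : c ∉ skewCells l m) :
    filling m M c = 0 := by
  obtain ⟨i, u⟩ := c
  by_contra hne
  obtain ⟨t, ht⟩ := Nat.exists_eq_succ_of_ne_zero hne
  obtain ⟨h1, h2⟩ := filling_eq_succ_iff.1 ht
  exact h ⟨(Nat.le_add_right _ _).trans h1, h2.trans_le (hM.bound_le i _)⟩

theorem ncard_filling_eq (hM : IsLRMatrix l m ν M) (n j : ℕ) :
    {c ∈ skewCells l m | filling m M c = j + 1 ∧ c.1 < n}.ncard =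
      ∑ i ∈ Finset.range n, M i j := by
  have hset : {c ∈ skewCells l m | filling m M c = j + 1 ∧ c.1 < n} =
      ((Finset.range n).sigma fun i => Finset.Ico (m i + ∑ t ∈ Finset.range j, M i t)
        (m i + ∑ t ∈ Finset.range (j + 1), M i t)).map
        (Equiv.sigmaEquivProd ℕ ℕ).toEmbedding := by
    ext ⟨i, u⟩
    simp only [Set.mem_ofPred_eq, Finset.coe_map, Set.mem_image, Finset.mem_coe,
      Finset.mem_sigma, Finset.mem_range, Equiv.coe_toEmbedding, Equiv.sigmaEquivProd_apply,
      filling_eq_succ_iff, Finset.mem_Ico]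
    constructor
    · rintro ⟨-, h, hn⟩
      exact ⟨⟨i, u⟩, ⟨hn, h⟩, rfl⟩
    · rintro ⟨⟨i', u'⟩, ⟨hn, h⟩, heq⟩
      simp only [Prod.mk.injEq] at heq
      obtain ⟨rfl, rfl⟩ := heq
      exact ⟨⟨(Nat.le_add_right _ _).trans h.1, h.2.trans_le (hM.bound_le _ _)⟩, h, hn⟩
  rw [hset, Set.ncard_coe_finset, Finset.card_map, Finset.card_sigma]
  refine Finset.sum_congr rfl fun i _ => ?_
  rw [Nat.card_Ico, Finset.sum_range_succ]
  omega

theorem isLRFilling (hM : IsLRMatrix l m ν M) (hl : IsPartition l) :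
    IsLRFilling (skewCells l m) ν (filling m M) := by
  have hfin : (skewCells l m).Finite := hl.finite_cellsOf.subset fun c hc => hc.2
  refine ⟨?_, ?_, ?_, ?_, ?_⟩
  · rintro ⟨i, u⟩ hc
    obtain ⟨t, ht⟩ := hM.exists_filling_eq_succ hc
    omega
  · rintro (_ | j) hj
    · omega
    obtain ⟨-, N, hN⟩ := hl
    obtain ⟨R, hRN, hR⟩ := ((Filter.eventually_ge_atTop N).and (hM.weight j)).exists
    rw [Nat.add_sub_cancel, ← hR, ← hM.ncard_filling_eq R j]
    congr 1
    ext ⟨i, u⟩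
    simp only [Set.mem_ofPred_eq]
    refine ⟨fun h => ⟨h.1, h.2, ?_⟩, fun h => ⟨h.1, h.2.1⟩⟩
    by_contra hi
    have h2 := h.1.2
    simp [hN i (by omega)] at h2
  · intro i u u' h h' huu'
    obtain ⟨t, ht⟩ := hM.exists_filling_eq_succ h
    obtain ⟨t', ht'⟩ := hM.exists_filling_eq_succ h'
    have h1 := filling_eq_succ_iff.1 ht
    have h2 := filling_eq_succ_iff.1 ht'
    rw [ht, ht']
    by_contra hlt
    have : ∑ j ∈ Finset.range (t' + 1), M i j ≤ ∑ j ∈ Finset.range t, M i j :=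
      Finset.sum_le_sum_of_subset (Finset.range_mono (by omega))
    omega
  · intro i i' u h h' hii'
    obtain ⟨t, ht⟩ := hM.exists_filling_eq_succ h
    obtain ⟨t', ht'⟩ := hM.exists_filling_eq_succ h'
    have h1 := filling_eq_succ_iff.1 ht
    have h2 := filling_eq_succ_iff.1 ht'
    rw [ht, ht']
    by_contra hlt
    obtain ⟨k, rfl⟩ := Nat.exists_eq_add_of_lt hii'
    have h3 := hM.strict_add i t (k + 1)
    have h4 : ∑ j ∈ Finset.range (t' + 1), M (i + k + 1) j ≤
        ∑ j ∈ Finset.range (t + (k + 1)), M (i + k + 1) j :=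
      Finset.sum_le_sum_of_subset (Finset.range_mono (by omega))
    rw [← add_assoc i k 1] at h3
    omega
  · rintro ⟨i, u⟩ - (_ | j) hj
    · omega
    calc _ ≤ {c ∈ skewCells l m | filling m M c = j + 1 + 1 ∧ c.1 < i + 1}.ncard := by
          refine Set.ncard_le_ncard (fun d hd => ⟨hd.1, hd.2.1, ?_⟩)
            (hfin.subset fun d hd => hd.1)
          rcases hd.2.2 with h | h
          · exact h.trans (Nat.lt_succ_self _)
          · exact h.1 ▸ Nat.lt_succ_self _
      _ ≤ {c ∈ skewCells l m | filling m M c = j + 1 ∧ c.1 < i}.ncard := by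
          rw [hM.ncard_filling_eq, hM.ncard_filling_eq]
          exact hM.lattice i j
      _ ≤ _ := by
          refine Set.ncard_le_ncard (fun d hd => ⟨hd.1, hd.2.1, Or.inl hd.2.2⟩)
            (hfin.subset fun d hd => hd.1)

end IsLRMatrix

theorem finite_setOf_isLRFilling {l m ν : ℕ → ℕ} (hl : IsPartition l) (hν : IsPartition ν) :
    {T : ℕ × ℕ → ℕ | (∀ i, m i ≤ l i) ∧ (∀ c, c ∉ skewCells l m → T c = 0) ∧
      IsLRFilling (skewCells l m) ν T}.Finite := by
  have hfin : (skewCells l m).Finite := hl.finite_cellsOf.subset fun c hc => hc.2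
  obtain ⟨-, N, hN⟩ := hν
  have := hfin.to_subtype
  have hpi := Set.Finite.pi' (ι := skewCells l m) (κ := fun _ => ℕ)
    (t := fun _ => Set.Iic N) fun _ => Set.finite_Iic N
  refine Set.Finite.of_finite_image (f := fun T (c : skewCells l m) => T c)
    (hpi.subset ?_) ?_
  · rintro _ ⟨T, ⟨-, -, hT⟩, rfl⟩ ⟨c, hc⟩
    change T c ≤ N
    by_contra hlt
    have h0 := hT.weight (T c) (hT.pos c hc)
    rw [hN _ (by omega), Set.ncard_eq_zero (hfin.subset fun d hd => hd.1)] at h0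
    exact (h0 ▸ (⟨hc, rfl⟩ : c ∈ {d ∈ skewCells l m | T d = T c}) : c ∈ (∅ : Set (ℕ × ℕ)))
  · rintro T ⟨-, hT, -⟩ T' ⟨-, hT', -⟩ heq
    funext c
    by_cases hc : c ∈ skewCells l m
    · exact congrFun heq ⟨c, hc⟩
    · rw [hT c hc, hT' c hc]

theorem LRPositive.LRcoeff_pos {l m ν : ℕ → ℕ} (h : LRPositive l m ν) (hl : IsPartition l)
    (hν : IsPartition ν) : 0 < LRcoeff l m ν := by
  obtain ⟨M, hM⟩ := h
  rw [LRcoeff, Set.ncard_pos (finite_setOf_isLRFilling hl hν)]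
  exact ⟨IsLRMatrix.filling m M, fun i => by simpa using hM.bound_le i 0,
    fun c hc => hM.filling_eq_zero hc, hM.isLRFilling hl⟩

/-! ### Constructions of Littlewood–Richardson matrices -/

namespace LRPositive

variable {l m ν l' m' ν' : ℕ → ℕ}

theorem zero : LRPositive 0 0 0 :=
  ⟨0, by simp, by simp, by simp, by simp⟩

theorem add (h : LRPositive l m ν) (h' : LRPositive l' m' ν') :
    LRPositive (l + l') (m + m') (ν + ν') := by
  obtain ⟨M, hM⟩ := h
  obtain ⟨M', hM'⟩ := h'
  refine ⟨M + M', fun i => ?_, fun j => ?_, fun i j => ?_, fun i j => ?_⟩ <;>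
    simp only [Pi.add_apply, Finset.sum_add_distrib]
  · have := hM.row_sum i
    have := hM'.row_sum i
    omega
  · filter_upwards [hM.weight j, hM'.weight j] with R h1 h2
    rw [h1, h2]
  · have := hM.strict i j
    have := hM'.strict i j
    omega
  · have := hM.lattice i j
    have := hM'.lattice i j
    omega

theorem of_add (hm : Antitone m) (hν : Antitone ν) : LRPositive (m + ν) m ν := by
  refine ⟨fun i j => if i = j then ν i else 0, fun i => ?_, fun j => ?_, fun i j => ?_,
    fun i j => ?_⟩
  · simp
  · filter_upwards [Filter.eventually_gt_atTop j] with R hR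
    simp [hR]
  · have := hm (Nat.le_add_right i 1)
    have := hν (Nat.le_add_right i 1)
    simp only [Finset.sum_ite_eq, Finset.mem_range]
    split_ifs <;> omega
  · have := hν (Nat.le_add_right j 1)
    simp only [Finset.sum_ite_eq', Finset.mem_range]
    split_ifs <;> omega

theorem column_add (x y : ℕ) : LRPositive (column (x + y)) (column x) (column y) := by
  refine ⟨fun i j => if j + x = i ∧ j < y then 1 else 0, fun i => ?_, fun j => ?_,
    fun i j => ?_, fun i j => ?_⟩
  · have : ∀ j, (j + x = i ∧ j < y) ↔ (i - x = j ∧ x ≤ i ∧ i < x + y) := by omega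
    simp only [this, ite_and, Finset.sum_ite_eq, column, Finset.mem_range]
    split_ifs <;> omega
  · filter_upwards [Filter.eventually_gt_atTop (j + x)] with R hR
    simp [ite_and, hR, column]
  · have : ∀ i j, (j + x = i ∧ j < y) ↔ (i - x = j ∧ x ≤ i ∧ i < x + y) := by omega
    simp only [this, ite_and, Finset.sum_ite_eq, column, Finset.mem_range]
    split_ifs <;> omega
  · simp only [ite_and, Finset.sum_ite_eq, Finset.mem_range]
    split_ifs <;> omega

theorem ofColumns_add (w : ℕ) (x y : ℕ → ℕ) :
    LRPositive (ofColumns w (x + y)) (ofColumns w x) (ofColumns w y) := by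
  induction w with
  | zero => exact zero
  | succ w ih =>
    have hsucc : ∀ z, ofColumns (w + 1) z = ofColumns w z + column (z w) := fun z => by
      funext i
      simp [ofColumns, Finset.sum_range_succ]
    rw [hsucc, hsucc, hsucc]
    exact ih.add (column_add (x w) (y w))

/-- Prepending a row that is filled with ones only. -/
theorem consPart (h : LRPositive l m ν) {s s' : ℕ} (hm : m 0 ≤ s) (hν : ν 0 ≤ s')
    (hl : l 0 ≤ s + s') :
    LRPositive (consPart (s + s') l) (consPart s m) (consPart s' ν) := by
  obtain ⟨M, hM⟩ := h
  let M' : ℕ → ℕ → ℕ := fun i j =>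
    if i = 0 then (if j = 0 then s' else 0) else (if j = 0 then 0 else M (i - 1) (j - 1))
  have hrow_zero : ∀ t, ∑ j ∈ Finset.range (t + 1), M' 0 j = s' := fun t => by
    simp [M']
  have hrow_succ : ∀ i t, ∑ j ∈ Finset.range (t + 1), M' (i + 1) j =
      ∑ j ∈ Finset.range t, M i j := fun i t => by simp [M', Finset.sum_range_succ' _ t]
  have hcol_zero : ∀ n, ∑ i ∈ Finset.range (n + 1), M' i 0 = s' := fun n => by
    simp [M']
  have hcol_succ : ∀ n j, ∑ i ∈ Finset.range (n + 1), M' i (j + 1) =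
      ∑ i ∈ Finset.range n, M i j := fun n j => by simp [M', Finset.sum_range_succ' _ n]
  refine ⟨M', ?_, ?_, ?_, ?_⟩
  · rintro (_ | i)
    · rw [hrow_zero]
      rfl
    · rw [hrow_succ]
      exact hM.row_sum i
  · rintro (_ | j)
    · filter_upwards [Filter.eventually_gt_atTop 0] with R hR
      obtain ⟨R, rfl⟩ := Nat.exists_eq_succ_of_ne_zero hR.ne'
      exact hcol_zero R
    · have hev := (Filter.tendsto_sub_atTop_nat 1).eventually (hM.weight j)
      filter_upwards [hev, Filter.eventually_gt_atTop 0] with R hR hpos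
      obtain ⟨R, rfl⟩ := Nat.exists_eq_succ_of_ne_zero hpos.ne'
      exact (hcol_succ R j).trans hR
  · rintro (_ | i) (_ | j)
    · rw [hrow_succ]
      exact hm
    · rw [hrow_succ, hrow_zero]
      exact (hM.bound_le 0 (j + 1)).trans hl
    · rw [hrow_succ]
      exact (Nat.le_add_right _ _).trans (hM.strict i 0)
    · rw [hrow_succ, hrow_succ]
      exact hM.strict i j
  · rintro (_ | i) j
    · rw [hcol_succ]
      exact Nat.zero_le _
    · rw [hcol_succ]
      rcases j with _ | j
      · rw [hcol_zero]
        refine le_trans ?_ hν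
        obtain ⟨R, hR, hsum⟩ := ((Filter.eventually_ge_atTop (i + 1)).and (hM.weight 0)).exists
        rw [← hsum]
        exact Finset.sum_le_sum_of_subset (Finset.range_mono hR)
      · rw [hcol_succ]
        exact hM.lattice i j

/-- The two-column shape `(2^{a+b+1}, 1^{a+b-2})` from `(2^a, 1^a)` and `(2^b, 1^b)`. -/
theorem two_columns {a b : ℕ} (ha : 0 < a) (hb : 0 < b) :
    LRPositive (column (2 * a + 2 * b - 1) + column (a + b + 1))
      (column (2 * a) + column a) (column (2 * b) + column b) := by
  let P : ℕ → ℕ → ℕ := fun i j => if j + a = i ∧ j ≤ b then 1 else 0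
  let Q : ℕ → ℕ → ℕ := fun i j => if j + 2 * a = i ∧ j < b then 1 else 0
  let Q' : ℕ → ℕ → ℕ := fun i j => if j - 1 + 2 * a = i ∧ b < j ∧ j < 2 * b then 1 else 0
  have hP : ∀ i t, ∑ j ∈ Finset.range t, P i j =
      if i - a < t ∧ a ≤ i ∧ i ≤ a + b then 1 else 0 := fun i t => by
    have h : ∀ j, (j + a = i ∧ j ≤ b) ↔ (i - a = j ∧ a ≤ i ∧ i ≤ a + b) := by omega
    simp only [P, h]
    simp only [ite_and, Finset.sum_ite_eq, Finset.mem_range]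
  have hQ : ∀ i t, ∑ j ∈ Finset.range t, Q i j =
      if i - 2 * a < t ∧ 2 * a ≤ i ∧ i < 2 * a + b then 1 else 0 := fun i t => by
    have h : ∀ j, (j + 2 * a = i ∧ j < b) ↔
        (i - 2 * a = j ∧ 2 * a ≤ i ∧ i < 2 * a + b) := by omega
    simp only [Q, h]
    simp only [ite_and, Finset.sum_ite_eq, Finset.mem_range]
  have hQ' : ∀ i t, ∑ j ∈ Finset.range t, Q' i j =
      if i + 1 - 2 * a < t ∧ 2 * a + b ≤ i ∧ i + 1 < 2 * a + 2 * b then 1 else 0 := fun i t => by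
    have h : ∀ j, (j - 1 + 2 * a = i ∧ b < j ∧ j < 2 * b) ↔
        (i + 1 - 2 * a = j ∧ 2 * a + b ≤ i ∧ i + 1 < 2 * a + 2 * b) := by omega
    simp only [Q', h]
    simp only [ite_and, Finset.sum_ite_eq, Finset.mem_range]
  have hPc : ∀ n j, ∑ i ∈ Finset.range n, P i j = if j + a < n ∧ j ≤ b then 1 else 0 :=
    fun n j => by simp only [P, ite_and, Finset.sum_ite_eq, Finset.mem_range]
  have hQc : ∀ n j, ∑ i ∈ Finset.range n, Q i j = if j + 2 * a < n ∧ j < b then 1 else 0 :=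
    fun n j => by simp only [Q, ite_and, Finset.sum_ite_eq, Finset.mem_range]
  have hQc' : ∀ n j, ∑ i ∈ Finset.range n, Q' i j =
      if j - 1 + 2 * a < n ∧ b < j ∧ j < 2 * b then 1 else 0 :=
    fun n j => by simp only [Q', ite_and, Finset.sum_ite_eq, Finset.mem_range]
  refine ⟨P + (Q + Q'), fun i => ?_, fun j => ?_, fun i j => ?_, fun i j => ?_⟩
  · simp only [Pi.add_apply, Finset.sum_add_distrib, hP, hQ, hQ', column]
    split_ifs <;> omega
  · filter_upwards [Filter.eventually_gt_atTop (j + 2 * a)] with R hR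
    simp only [Pi.add_apply, Finset.sum_add_distrib, hPc, hQc, hQc', column]
    split_ifs <;> omega
  · have h1 : column a (i + 1) + ∑ t ∈ Finset.range (j + 1), P (i + 1) t ≤
        column a i + ∑ t ∈ Finset.range j, P i t := by
      simp only [hP, column]
      split_ifs <;> omega
    have h2 : column (2 * a) (i + 1) + (∑ t ∈ Finset.range (j + 1), Q (i + 1) t +
        ∑ t ∈ Finset.range (j + 1), Q' (i + 1) t) ≤
        column (2 * a) i + (∑ t ∈ Finset.range j, Q i t + ∑ t ∈ Finset.range j, Q' i t) := by
      simp only [hQ, hQ', column]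
      split_ifs <;> omega
    simp only [Pi.add_apply, Finset.sum_add_distrib]
    omega
  · simp only [Pi.add_apply, Finset.sum_add_distrib, hPc, hQc, hQc']
    split_ifs <;> omega

end LRPositive

/-! ### Bounds on the constituents of a product -/

section Bounds

variable {l m ν : ℕ → ℕ} {T : ℕ × ℕ → ℕ}

theorem IsLRFilling.ncard_eq_psize (hT : IsLRFilling (skewCells l m) ν T)
    (hl : IsPartition l) (hν : IsPartition ν) : (skewCells l m).ncard = psize ν := by
  have hfin : (skewCells l m).Finite := hl.finite_cellsOf.subset fun c hc => hc.2
  obtain ⟨-, N, hN⟩ := hν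
  have hmaps : ∀ c ∈ hfin.toFinset, T c - 1 ∈ Finset.range N := by
    intro c hc
    rw [Set.Finite.mem_toFinset] at hc
    rw [Finset.mem_range]
    by_contra hlt
    have h0 := hT.weight (T c) (hT.pos c hc)
    rw [hN _ (by omega), Set.ncard_eq_zero (hfin.subset fun d hd => hd.1)] at h0
    exact (h0 ▸ (⟨hc, rfl⟩ : c ∈ {d ∈ skewCells l m | T d = T c}) : c ∈ (∅ : Set (ℕ × ℕ)))
  rw [psize_eq_sum hN, Set.ncard_eq_toFinset_card _ hfin,
    Finset.card_eq_sum_card_fiberwise hmaps]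
  refine Finset.sum_congr rfl fun j _ => ?_
  have hw := hT.weight (j + 1) (by omega)
  rw [Nat.add_sub_cancel] at hw
  rw [← hw, ← Set.ncard_coe_finset]
  congr 1
  ext c
  simp only [Finset.coe_filter, Set.Finite.mem_toFinset, Set.mem_ofPred_eq]
  refine and_congr_right fun hc => ?_
  have := hT.pos c hc
  omega

theorem IsLRFilling.psize_eq (hT : IsLRFilling (skewCells l m) ν T) (hml : ∀ i, m i ≤ l i)
    (hl : IsPartition l) (hν : IsPartition ν) : psize l = psize m + psize ν := by
  have hfin : (skewCells l m).Finite := hl.finite_cellsOf.subset fun c hc => hc.2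
  have hmfin : (cellsOf m).Finite :=
    hl.finite_cellsOf.subset fun c (hc : c.2 < m c.1) => hc.trans_le (hml c.1)
  rw [← hT.ncard_eq_psize hl hν, psize, psize, ← Set.ncard_union_eq ?_ hmfin hfin]
  · congr 1
    ext ⟨i, u⟩
    have := hml i
    simp only [cellsOf, skewCells, Set.mem_union, Set.mem_ofPred_eq]
    omega
  · rw [Set.disjoint_left]
    rintro ⟨i, u⟩ (h : u < m i) ⟨h', -⟩
    exact absurd h (not_lt.2 h')

theorem IsLRFilling.first_row_le (hT : IsLRFilling (skewCells l m) ν T)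
    (hl : IsPartition l) : l 0 ≤ m 0 + ν 0 := by
  have hfin : (skewCells l m).Finite := hl.finite_cellsOf.subset fun c hc => hc.2
  have hone : ∀ u, m 0 ≤ u → u < l 0 → T (0, u) = 1 := by
    intro u h1 h2
    have hlast : (0, l 0 - 1) ∈ skewCells l m := ⟨by simp only; omega, by simp only; omega⟩
    have hu : (0, u) ∈ skewCells l m := ⟨h1, h2⟩
    have hpos := hT.pos _ hu
    have hle := hT.row_weak 0 u (l 0 - 1) hu hlast (by omega)
    suffices T (0, l 0 - 1) ≤ 1 by omega
    by_contra hgt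
    obtain ⟨t, ht⟩ : ∃ t, T (0, l 0 - 1) = t + 2 := ⟨T (0, l 0 - 1) - 2, by omega⟩
    have hlat := hT.lattice _ hlast (t + 1) (by omega)
    have hp : 0 < {d ∈ skewCells l m | T d = t + 1 + 1 ∧ readBefore d (0, l 0 - 1)}.ncard :=
      (Set.ncard_pos (hfin.subset fun d hd => hd.1)).2
        ⟨(0, l 0 - 1), hlast, by omega, Or.inr ⟨rfl, le_rfl⟩⟩
    obtain ⟨⟨i, v⟩, hd, hTd, hread⟩ :=
      (Set.ncard_pos (hfin.subset fun d hd => hd.1)).1 (hp.trans_le hlat)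
    obtain ⟨-, hd2⟩ := hd
    rcases hread with h | ⟨h, h'⟩
    · simp at h
    · simp only at h h' hd2
      subst h
      obtain rfl : v = l 0 - 1 := by omega
      omega
  have hw := hT.weight 1 le_rfl
  have hsub : (fun u => ((0 : ℕ), u)) '' Set.Ico (m 0) (l 0) ⊆ {c ∈ skewCells l m | T c = 1} := by
    rintro _ ⟨u, ⟨h1, h2⟩, rfl⟩
    exact ⟨⟨h1, h2⟩, hone u h1 h2⟩
  have hcard := Set.ncard_le_ncard hsub (hfin.subset fun d hd => hd.1)
  rw [hw, Set.ncard_image_of_injective _ (Prod.mk_right_injective 0), ← Finset.coe_Ico,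
    Set.ncard_coe_finset, Nat.card_Ico] at hcard
  simp only [Nat.sub_self] at hcard
  omega

theorem IsLRFilling.length_le (hT : IsLRFilling (skewCells l m) ν T)
    (hl : IsPartition l) (hm : IsPartition m) (hν : IsPartition ν) :
    conj l 0 ≤ conj m 0 + conj ν 0 := by
  have hfin : (skewCells l m).Finite := hl.finite_cellsOf.subset fun c hc => hc.2
  have hmem : ∀ i ∈ Finset.Ico (conj m 0) (conj l 0), (i, 0) ∈ skewCells l m := by
    intro i hi
    rw [Finset.mem_Ico, hm.conj_le_iff, hl.lt_conj_iff] at hi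
    exact hi
  have hcard : (Finset.Ico (conj m 0) (conj l 0)).card ≤ (Finset.range (conj ν 0)).card := by
    refine Finset.card_le_card_of_injOn (fun i => T (i, 0) - 1) (fun i hi => ?_) ?_
    · rw [Finset.mem_coe] at hi
      have hc := hmem i hi
      rw [Finset.coe_range, Set.mem_Iio, hν.lt_conj_iff, ← hT.weight _ (hT.pos _ hc),
        Set.ncard_pos (hfin.subset fun d hd => hd.1)]
      exact ⟨(i, 0), hc, rfl⟩
    · intro i hi i' hi' heq
      rw [Finset.mem_coe] at hi hi'
      have h1 := hT.pos _ (hmem i hi)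
      have h2 := hT.pos _ (hmem i' hi')
      simp only at heq
      rcases lt_trichotomy i i' with h | h | h
      · have := hT.col_strict i i' 0 (hmem i hi) (hmem i' hi') h
        omega
      · exact h
      · have := hT.col_strict i' i 0 (hmem i' hi') (hmem i hi) h
        omega
  rw [Nat.card_Ico, Finset.card_range] at hcard
  omega

theorem starOp_Bset_subset (n n' t t' : ℕ) :
    starOp (Bset n t) (Bset n' t') ⊆ Bset (n + n') (t + t') := by
  rintro l ⟨hl, m, ⟨⟨hm, hmn⟩, hm0, hmc⟩, ν, ⟨⟨hν, hνn⟩, hν0, hνc⟩, hpos⟩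
  obtain ⟨T, hml, -, hT⟩ := Set.nonempty_of_ncard_ne_zero hpos.ne'
  have h1 := hT.psize_eq hml hl hν
  have h2 := hT.first_row_le hl
  have h3 := hT.length_le hl hm hν
  exact ⟨⟨hl, by omega⟩, by omega, by omega⟩

end Bounds

/-! ### Membership in `Cset` -/

section Membership

variable {f α : ℕ → ℕ}

theorem IsPartition.first_le_psize (hf : IsPartition f) : f 0 ≤ psize f := by
  obtain ⟨hanti, N, hN⟩ := hf
  rw [psize_eq_sum (N := N + 1) fun i hi => hN i (by omega)]
  exact Finset.single_le_sum (fun i _ => Nat.zero_le (f i)) (by simp)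

theorem IsPartition.sum_conj (hf : IsPartition f) :
    ∑ j ∈ Finset.range (f 0), conj f j = psize f := by
  rw [← psize_ofColumns, hf.ofColumns_conj_eq]

theorem IsPartition.length_le_psize (hf : IsPartition f) : conj f 0 ≤ psize f := by
  rcases Nat.eq_zero_or_pos (f 0) with h | h
  · exact (hf.conj_le_iff.2 h.le).trans (Nat.zero_le _)
  · rw [← hf.sum_conj]
    exact Finset.single_le_sum (fun i _ => Nat.zero_le (conj f i)) (by simpa using h)

theorem IsPartition.consPart (hα : IsPartition α) {s : ℕ} (hs : α 0 ≤ s) :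
    IsPartition (consPart s α) := by
  obtain ⟨hanti, N, hN⟩ := hα
  refine ⟨antitone_nat_of_succ_le fun i => ?_, N + 1, fun i hi => ?_⟩
  · rcases i with _ | i
    · simpa [SylowBranching.consPart] using hs
    · simpa [SylowBranching.consPart] using hanti (Nat.le_add_right i 1)
  · simp only [SylowBranching.consPart]
    rw [if_neg (by omega), hN _ (by omega)]

theorem psize_consPart (hα : IsPartition α) (s : ℕ) : psize (consPart s α) = s + psize α := by
  obtain ⟨hanti, N, hN⟩ := hα
  rw [psize_eq_sum hN, psize_eq_sum (N := N + 1), Finset.sum_range_succ', add_comm]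
  · simp [consPart]
  · intro i hi
    simp only [consPart]
    rw [if_neg (by omega), hN _ (by omega)]

theorem conj_consPart_zero (hα : IsPartition α) {s : ℕ} (hs : α 0 ≤ s) (hpos : 0 < s) :
    conj (consPart s α) 0 = conj α 0 + 1 := by
  refine eq_of_forall_lt_iff fun i => ?_
  rw [(hα.consPart hs).lt_conj_iff]
  rcases i with _ | i
  · simpa [consPart] using hpos
  · rw [Nat.add_lt_add_iff_right, hα.lt_conj_iff]
    simp [consPart]

theorem isPartition_zero : IsPartition 0 := ⟨fun _ _ _ => le_rfl, 0, fun _ _ => rfl⟩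

theorem psize_zero : psize 0 = 0 :=
  (psize_eq_sum (f := 0) (N := 0) fun _ _ => rfl).trans (by simp)

theorem column_eq_ofColumns (n : ℕ) : column n = ofColumns 1 fun _ => n := by
  funext i
  simp [ofColumns]

theorem psize_column (n : ℕ) : psize (column n) = n := by
  rw [column_eq_ofColumns, psize_ofColumns]
  simp

theorem conj_column_zero (n : ℕ) : conj (column n) 0 = n := by
  refine eq_of_forall_lt_iff fun i => ?_
  rw [(isPartition_column n).lt_conj_iff, column]
  split_ifs <;> omega

theorem IsPartition.column_add (hα : IsPartition α) (s : ℕ) : IsPartition (column s + α) := by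
  refine ⟨(antitone_column s).add hα.1, ?_⟩
  obtain ⟨-, N, hN⟩ := hα
  refine ⟨s + N, fun i hi => ?_⟩
  rw [Pi.add_apply, hN i (by omega), column, if_neg (by omega)]

theorem psize_column_add (hα : IsPartition α) (s : ℕ) :
    psize (column s + α) = s + psize α := by
  obtain ⟨hanti, N, hN⟩ := hα
  have h1 : ∀ i, s + N ≤ i → column s i = 0 := fun i hi => by
    rw [column, if_neg (by omega)]
  have h2 : ∀ i, s + N ≤ i → α i = 0 := fun i hi => hN i (by omega)
  rw [psize_eq_sum h2, psize_eq_sum (N := s + N) fun i hi => by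
    rw [Pi.add_apply, h1 i hi, h2 i hi]]
  simp only [Pi.add_apply, Finset.sum_add_distrib]
  rw [← psize_eq_sum h1, psize_column]

theorem conj_column_add_zero (hα : IsPartition α) {s : ℕ} (hs : conj α 0 ≤ s) :
    conj (column s + α) 0 = s := by
  refine eq_of_forall_lt_iff fun i => ?_
  have h := hα.lt_conj_iff (i := i) (j := 0)
  rw [(hα.column_add s).lt_conj_iff, Pi.add_apply, column]
  split_ifs <;> omega

theorem conj_column_add_one (hα : IsPartition α) {s : ℕ} (hs : conj α 0 ≤ s) :
    conj (column s + α) 1 = conj α 0 := by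
  refine eq_of_forall_lt_iff fun i => ?_
  rw [(hα.column_add s).lt_conj_iff, Pi.add_apply, column]
  have h := hα.lt_conj_iff (i := i) (j := 0)
  split_ifs <;> omega

theorem isPartition_ofList {L : List ℕ} (hL : L.Pairwise (· ≥ ·)) : IsPartition (ofList L) := by
  refine ⟨fun i j hij => ?_, L.length, fun i hi => by simp [ofList, hi]⟩
  simp only [ofList]
  by_cases hj : j < L.length
  · rw [List.getD_eq_getElem _ _ hj, List.getD_eq_getElem _ _ (hij.trans_lt hj)]
    rcases hij.eq_or_lt with rfl | hlt
    · exact le_rfl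
    · exact List.pairwise_iff_getElem.1 hL i j (hij.trans_lt hj) hj hlt
  · rw [List.getD_eq_default _ _ (not_lt.1 hj)]
    exact Nat.zero_le _

theorem conj_ofList_zero {L : List ℕ} (hL : L.Pairwise (· ≥ ·)) (hpos : ∀ x ∈ L, 0 < x) :
    conj (ofList L) 0 = L.length := by
  refine eq_of_forall_lt_iff fun i => ?_
  rw [(isPartition_ofList hL).lt_conj_iff, ofList]
  by_cases hi : i < L.length
  · simp only [List.getD_eq_getElem _ _ hi, hi, iff_true]
    exact hpos _ (List.getElem_mem hi)
  · simp [hi]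

/-- The first two parts and the length of `f` distinguish it from the partitions
`(2a, a−1, 1)`, `(2a, 2, 1^{a−2})`, `(2a−1, a+1)` and `(2a−1, 1^{a+1})`. -/
def AvoidsExceptions (a : ℕ) (f : ℕ → ℕ) : Prop :=
  (f 0 = 2 * a → f 1 ≠ a - 1 ∧ conj f 0 ≠ a) ∧
    (f 0 = 2 * a - 1 → f 1 ≠ a + 1 ∧ conj f 0 ≠ a + 2)

theorem mem_Cset {k a : ℕ} (hk : 1 ≤ k) (ha : a = 3 ^ (k - 1)) (ha3 : 3 ≤ a)
    (hf : IsPartition f) (hsize : psize f = 3 * a) (h0 : f 0 ≤ 2 * a) (hc : conj f 0 ≤ 2 * a)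
    (hav : AvoidsExceptions a f) (hav' : AvoidsExceptions a (conj f)) : f ∈ Cset k := by
  have hpow : 3 ^ k = 3 * a := by
    rw [ha, ← pow_succ', Nat.sub_add_cancel hk]
  rw [Cset, hpow, ← ha]
  refine ⟨⟨⟨hf, hsize⟩, h0, hc⟩, ?_⟩
  have key : ∀ e, e ∈ ({ofList [2 * a, a - 1, 1],
      ofList (2 * a :: 2 :: List.replicate (a - 2) 1), ofList [2 * a - 1, a + 1],
      hookP (2 * a - 1) (a + 1)} : Set (ℕ → ℕ)) → IsPartition e ∧ ¬ AvoidsExceptions a e := by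
    rintro e (rfl | rfl | rfl | rfl)
    · refine ⟨isPartition_ofList ?_, fun h => (h.1 (by simp [ofList])).1 (by simp [ofList])⟩
      simp only [List.pairwise_cons, List.mem_cons, List.not_mem_nil]
      simp
      omega
    · have hp : (2 * a :: 2 :: List.replicate (a - 2) 1).Pairwise (· ≥ ·) := by
        simp only [List.pairwise_cons, List.mem_cons, List.mem_replicate]
        refine ⟨?_, ?_, ?_⟩
        · rintro x (rfl | ⟨-, rfl⟩) <;> omega
        · rintro x ⟨-, rfl⟩
          omega
        · simp [List.pairwise_replicate]
      refine ⟨isPartition_ofList hp, fun h => (h.1 (by simp [ofList])).2 ?_⟩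
      rw [conj_ofList_zero hp]
      · simp
        omega
      · simp only [List.mem_cons, List.mem_replicate]
        rintro x (rfl | rfl | ⟨-, rfl⟩) <;> omega
    · refine ⟨isPartition_ofList ?_, fun h => (h.2 (by simp [ofList])).1 (by simp [ofList])⟩
      simp
      omega
    · have hp : List.Pairwise (· ≥ ·) ((2 * a - 1) :: List.replicate (a + 1) 1) := by
        simp only [List.pairwise_cons, List.mem_replicate]
        refine ⟨?_, ?_⟩
        · rintro x ⟨-, rfl⟩
          omega
        · simp [List.pairwise_replicate]
      refine ⟨isPartition_ofList hp, fun h => (h.2 (by simp [hookP, ofList])).2 ?_⟩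
      rw [hookP, conj_ofList_zero hp]
      · simp
      · simp only [List.mem_cons, List.mem_replicate]
        rintro x (rfl | ⟨-, rfl⟩) <;> omega
  rintro (h | ⟨e, he, rfl⟩)
  · exact (key f h).2 hav
  · obtain ⟨hp, hn⟩ := key e he
    rw [hp.conj_conj] at hav'
    exact hn hav'

/-- `α` can be completed, by a first row or a first column of length `s`, to an element of the
set `C` attached to `a`. -/
structure IsTail (a s : ℕ) (α : ℕ → ℕ) : Prop where
  isPartition : IsPartition α
  psize_add : psize α + s = 3 * a
  le_two_mul : 3 * a ≤ 2 * s
  le : s ≤ 2 * a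
  ne_of_eq : s = 2 * a → α 0 ≠ a - 1 ∧ conj α 0 ≠ a - 1
  ne_of_succ_eq : s + 1 = 2 * a → α 0 ≠ a + 1 ∧ conj α 0 ≠ a + 1

theorem IsTail.first_le {a s : ℕ} (h : IsTail a s α) : α 0 ≤ s := by
  have h1 := h.isPartition.first_le_psize
  have h2 := h.psize_add
  have h3 := h.le_two_mul
  omega

theorem IsTail.length_le {a s : ℕ} (h : IsTail a s α) : conj α 0 ≤ s := by
  have h1 := h.isPartition.length_le_psize
  have h2 := h.psize_add
  have h3 := h.le_two_mul
  omega

theorem IsTail.consPart_mem_Cset {k a s : ℕ} (hk : 1 ≤ k) (ha : a = 3 ^ (k - 1)) (ha5 : 5 ≤ a)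
    (h : IsTail a s α) : consPart s α ∈ Cset k := by
  have hp := h.isPartition
  have h1 := hp.first_le_psize
  have h2 := hp.length_le_psize
  have h3 := h.psize_add
  have h4 := h.le_two_mul
  have h5 := h.le
  have h6 := h.ne_of_eq
  have h7 := h.ne_of_succ_eq
  have hc := conj_consPart_zero hp h.first_le (by omega)
  have e0 : consPart s α 0 = s := rfl
  have e1 : consPart s α 1 = α 0 := rfl
  refine mem_Cset hk ha (by omega) (hp.consPart h.first_le) ?_ (by omega) (by omega) ?_ ?_
  · rw [psize_consPart hp]
    omega
  · constructor <;> intro h <;> omega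
  · constructor <;> intro h <;> omega

theorem IsTail.column_add_mem_Cset {k a s : ℕ} (hk : 1 ≤ k) (ha : a = 3 ^ (k - 1)) (ha5 : 5 ≤ a)
    (h : IsTail a s α) : column s + α ∈ Cset k := by
  have hp := h.isPartition
  have h1 := hp.first_le_psize
  have h2 := hp.length_le_psize
  have h3 := h.psize_add
  have h4 := h.le_two_mul
  have h5 := h.le
  have h6 := h.ne_of_eq
  have h7 := h.ne_of_succ_eq
  have hc0 := conj_column_add_zero hp h.length_le
  have hc1 := conj_column_add_one hp h.length_le
  have hcc := congrFun (hp.column_add s).conj_conj 0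
  have e0 : (column s + α) 0 = 1 + α 0 := by
    rw [Pi.add_apply, column, if_pos (by omega)]
  refine mem_Cset hk ha (by omega) (hp.column_add s) ?_ (by omega) (by omega) ?_ ?_
  · rw [psize_column_add hp]
    omega
  · constructor <;> intro h <;> omega
  · constructor <;> intro h <;> omega

theorem mem_Cset_of_le {k a : ℕ} (hk : 1 ≤ k) (ha : a = 3 ^ (k - 1)) (ha3 : 3 ≤ a)
    (hf : IsPartition f) (hsize : psize f = 3 * a) (h0 : f 0 ≤ 2 * a - 2)
    (hc : conj f 0 ≤ 2 * a - 2) : f ∈ Cset k := by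
  refine mem_Cset hk ha ha3 hf hsize (by omega) (by omega) ?_ ?_
  · constructor <;> intro h <;> omega
  · constructor <;> intro h <;> omega

theorem isTail_row {a : ℕ} (ha : 3 ≤ a) : IsTail a (2 * a) (consPart a 0) := by
  have hc := conj_consPart_zero isPartition_zero (Nat.zero_le a) (by omega)
  have hz : conj 0 0 = 0 := Nat.le_zero.1 (isPartition_zero.conj_le_iff.2 le_rfl)
  have e0 : consPart a 0 0 = a := rfl
  refine ⟨isPartition_zero.consPart (Nat.zero_le a), ?_, by omega, le_rfl, fun _ => by omega,
    fun h => by omega⟩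
  rw [psize_consPart isPartition_zero, psize_zero]
  omega

theorem isTail_column {a : ℕ} (ha : 3 ≤ a) : IsTail a (2 * a) (column a) := by
  have hc := conj_column_zero a
  have e0 : column a 0 = 1 := by rw [column, if_pos (by omega)]
  refine ⟨isPartition_column a, ?_, by omega, le_rfl, fun _ => by omega, fun h => by omega⟩
  rw [psize_column]
  omega

end Membership

/-! ### Distributing the columns of a partition -/

section Split

open Finset

variable {w : ℕ} {x y c d : ℕ → ℕ}

theorem exists_sum_eq {l u : ℕ → ℕ} (h : ∀ j < w, l j ≤ u j) {A : ℕ}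
    (hl : ∑ j ∈ range w, l j ≤ A) (hu : A ≤ ∑ j ∈ range w, u j) :
    ∃ x : ℕ → ℕ, (∀ j < w, l j ≤ x j ∧ x j ≤ u j) ∧ ∑ j ∈ range w, x j = A := by
  induction w generalizing A with
  | zero => exact ⟨0, by simp, by simp at hu ⊢; omega⟩
  | succ w ih =>
    rw [sum_range_succ] at hl hu
    have hw := h w (by omega)
    have hsum : ∑ j ∈ range w, l j ≤ ∑ j ∈ range w, u j :=
      sum_le_sum fun j hj => h j (by rw [mem_range] at hj; omega)
    obtain ⟨x, hx, hxs⟩ := ih (fun j hj => h j (by omega))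
      (A := A - max (l w) (A - ∑ j ∈ range w, u j)) (by omega) (by omega)
    refine ⟨fun j => if j = w then max (l w) (A - ∑ j ∈ range w, u j) else x j,
      fun j hj => ?_, ?_⟩
    · by_cases hjw : j = w
      · subst hjw
        simp only [if_true]
        omega
      · simpa only [hjw, if_false] using hx j (by omega)
    · rw [sum_range_succ, if_pos rfl,
        sum_congr rfl fun j hj => if_neg (by rw [mem_range] at hj; omega), hxs]
      omega

theorem exists_add_eq_of_add_le {lx ly : ℕ → ℕ} (h : ∀ j < w, lx j + ly j ≤ d j) {A B : ℕ}
    (hA : ∑ j ∈ range w, lx j ≤ A) (hB : ∑ j ∈ range w, ly j ≤ B)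
    (hAB : A + B = ∑ j ∈ range w, d j) :
    ∃ x y : ℕ → ℕ, (∀ j < w, x j + y j = d j) ∧ (∀ j < w, lx j ≤ x j) ∧ (∀ j < w, ly j ≤ y j) ∧
      ∑ j ∈ range w, x j = A ∧ ∑ j ∈ range w, y j = B := by
  have hu : ∑ j ∈ range w, (d j - ly j) + ∑ j ∈ range w, ly j = ∑ j ∈ range w, d j := by
    rw [← sum_add_distrib]
    refine sum_congr rfl fun j hj => ?_
    have := h j (mem_range.1 hj)
    omega
  obtain ⟨x, hx, hxs⟩ := exists_sum_eq (w := w) (l := lx) (u := fun j => d j - ly j)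
    (fun j hj => by have := h j hj; omega) hA (by omega)
  have hxd : ∀ j < w, x j + (d j - x j) = d j := fun j hj => by
    have := h j hj
    have := hx j hj
    omega
  refine ⟨x, fun j => d j - x j, hxd, fun j hj => (hx j hj).1, fun j hj => ?_, hxs, ?_⟩
  · have := h j hj
    have := hx j hj
    dsimp only
    omega
  · have : ∑ j ∈ range w, x j + ∑ j ∈ range w, (d j - x j) = ∑ j ∈ range w, d j := by
      rw [← sum_add_distrib]
      exact sum_congr rfl fun j hj => hxd j (mem_range.1 hj)
    dsimp only
    omega

/-- The partition with columns `x 0, …, x (w - 1)` has at least `n` cells outside its first row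
and at least `n` cells outside its first column. -/
def IsFat (n w : ℕ) (x : ℕ → ℕ) : Prop :=
  (∀ j < w, x j + n ≤ ∑ j ∈ range w, x j) ∧
    ∑ j ∈ range w, min (x j) 1 + n ≤ ∑ j ∈ range w, x j

theorem IsFat.mono {n : ℕ} (h : IsFat n w c) (hcx : ∀ j < w, c j ≤ x j) : IsFat n w x := by
  have hsum : ∑ j ∈ range w, c j + ∑ j ∈ range w, (x j - c j) = ∑ j ∈ range w, x j := by
    rw [← sum_add_distrib]
    refine sum_congr rfl fun j hj => ?_
    have := hcx j (mem_range.1 hj)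
    omega
  refine ⟨fun j hj => ?_, ?_⟩
  · have h1 := h.1 j hj
    have h2 : x j - c j ≤ ∑ j ∈ range w, (x j - c j) :=
      single_le_sum (f := fun j => x j - c j) (fun _ _ => Nat.zero_le _) (mem_range.2 hj)
    omega
  · have h1 := h.2
    have h2 : ∑ j ∈ range w, min (x j) 1 ≤
        ∑ j ∈ range w, min (c j) 1 + ∑ j ∈ range w, (x j - c j) := by
      rw [← sum_add_distrib]
      exact sum_le_sum fun j _ => by omega
    omega

theorem sum_single_le (w i v : ℕ) : ∑ j ∈ range w, (Pi.single i v : ℕ → ℕ) j ≤ v := by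
  rw [sum_pi_single']
  split_ifs <;> omega

theorem sum_single_eq {i : ℕ} (hi : i < w) (v : ℕ) :
    ∑ j ∈ range w, (Pi.single i v : ℕ → ℕ) j = v := by
  rw [sum_pi_single', if_pos (mem_range.2 hi)]

theorem isFat_two_two {i j : ℕ} (hi : i < w) (hj : j < w) (hij : i ≠ j) :
    IsFat 2 w (Pi.single i 2 + Pi.single j 2) := by
  have hs : ∑ t ∈ range w, (Pi.single i 2 + Pi.single j 2 : ℕ → ℕ) t = 4 := by
    simp only [Pi.add_apply, sum_add_distrib, sum_single_eq hi, sum_single_eq hj]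
  have hm : ∑ t ∈ range w, min ((Pi.single i 2 + Pi.single j 2 : ℕ → ℕ) t) 1 ≤ 2 := by
    refine (sum_le_sum (g := (Pi.single i 1 + Pi.single j 1 : ℕ → ℕ)) fun t _ => ?_).trans ?_
    · simp only [Pi.add_apply, Pi.single_apply]
      split_ifs <;> omega
    · simp only [Pi.add_apply, sum_add_distrib, sum_single_eq hi, sum_single_eq hj]
      omega
  refine ⟨fun t ht => ?_, by omega⟩
  rw [hs]
  simp only [Pi.add_apply, Pi.single_apply]
  split_ifs <;> omega

theorem isFat_three_one_one {i j k : ℕ} (hi : i < w) (hj : j < w) (hk : k < w) (hij : i ≠ j)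
    (hik : i ≠ k) : IsFat 2 w (Pi.single i 3 + Pi.single j 1 + Pi.single k 1) := by
  have hs : ∑ t ∈ range w, (Pi.single i 3 + Pi.single j 1 + Pi.single k 1 : ℕ → ℕ) t = 5 := by
    simp only [Pi.add_apply, sum_add_distrib, sum_single_eq hi, sum_single_eq hj,
      sum_single_eq hk]
  have hm : ∑ t ∈ range w,
      min ((Pi.single i 3 + Pi.single j 1 + Pi.single k 1 : ℕ → ℕ) t) 1 ≤ 3 := by
    refine (sum_le_sum (g := (Pi.single i 1 + Pi.single j 1 + Pi.single k 1 : ℕ → ℕ))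
      fun t _ => ?_).trans ?_
    · simp only [Pi.add_apply, Pi.single_apply]
      split_ifs <;> omega
    · simp only [Pi.add_apply, sum_add_distrib, sum_single_eq hi, sum_single_eq hj,
        sum_single_eq hk]
      omega
  refine ⟨fun t ht => ?_, by omega⟩
  rw [hs]
  simp only [Pi.add_apply, Pi.single_apply]
  split_ifs <;> omega

theorem isFat_two_one {i j : ℕ} (hi : i < w) (hj : j < w) (hij : i ≠ j) :
    IsFat 1 w (Pi.single i 2 + Pi.single j 1) := by
  have hs : ∑ t ∈ range w, (Pi.single i 2 + Pi.single j 1 : ℕ → ℕ) t = 3 := by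
    simp only [Pi.add_apply, sum_add_distrib, sum_single_eq hi, sum_single_eq hj]
  have hm : ∑ t ∈ range w, min ((Pi.single i 2 + Pi.single j 1 : ℕ → ℕ) t) 1 ≤ 2 := by
    refine (sum_le_sum (g := (Pi.single i 1 + Pi.single j 1 : ℕ → ℕ)) fun t _ => ?_).trans ?_
    · simp only [Pi.add_apply, Pi.single_apply]
      split_ifs <;> omega
    · simp only [Pi.add_apply, sum_add_distrib, sum_single_eq hi, sum_single_eq hj]
      omega
  refine ⟨fun t ht => ?_, by omega⟩
  rw [hs]
  simp only [Pi.add_apply, Pi.single_apply]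
  split_ifs <;> omega

theorem IsFat.first_add_le {n : ℕ} (h : IsFat n w x) :
    ofColumns w x 0 + n ≤ ∑ j ∈ range w, x j := by
  rw [ofColumns_zero_eq]
  exact h.2

theorem IsFat.length_add_le {n : ℕ} (h : IsFat n w x) :
    conj (ofColumns w x) 0 + n ≤ ∑ j ∈ range w, x j := by
  have h1 : conj (ofColumns w x) 0 ≤ ∑ j ∈ range w, x j - n :=
    conj_ofColumns_le_iff.2 fun j hj => by
      have := h.1 j hj
      omega
  have := h.2
  omega

theorem isTail_ofColumns {a s : ℕ} (hsum : ∑ j ∈ range w, x j + s = 3 * a)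
    (hs : 3 * a ≤ 2 * s) (hs' : s ≤ 2 * a) (h2 : s = 2 * a → IsFat 2 w x)
    (h1 : s + 1 = 2 * a → IsFat 1 w x) : IsTail a s (ofColumns w x) := by
  refine ⟨isPartition_ofColumns w x, by rw [psize_ofColumns, hsum], hs, hs', fun h => ?_,
    fun h => ?_⟩
  · have := (h2 h).first_add_le
    have := (h2 h).length_add_le
    omega
  · have := (h1 h).first_add_le
    have := (h1 h).length_add_le
    omega

/-- The partition with columns `x 0, …, x (w - 1)` is a single row, or a single column, or has at
least two cells outside its first row and at least two cells outside its first column. -/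
def IsGood (w : ℕ) (x : ℕ → ℕ) : Prop :=
  (∀ j < w, x j ≤ 1) ∨ (∃ i < w, x i = ∑ j ∈ range w, x j) ∨ IsFat 2 w x

theorem IsGood.isTail {a : ℕ} (h : IsGood w x) (ha : 3 ≤ a) (hsum : ∑ j ∈ range w, x j = a) :
    IsTail a (2 * a) (ofColumns w x) := by
  rcases h with h | ⟨i, hi, hxi⟩ | h
  · refine ⟨isPartition_ofColumns w x, by rw [psize_ofColumns]; omega, by omega, le_rfl,
      fun _ => ?_, by omega⟩
    have h1 : ofColumns w x 0 = a := by
      rw [ofColumns_zero_eq, ← hsum]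
      refine sum_congr rfl fun j hj => ?_
      have := h j (mem_range.1 hj)
      omega
    have h2 : conj (ofColumns w x) 0 ≤ 1 := conj_ofColumns_le_iff.2 h
    omega
  · refine ⟨isPartition_ofColumns w x, by rw [psize_ofColumns]; omega, by omega, le_rfl,
      fun _ => ?_, by omega⟩
    have h1 : ofColumns w x 0 ≤ 1 := by
      have hx := add_sum_erase _ x (mem_range.2 hi)
      rw [ofColumns_zero_eq, ← add_sum_erase _ _ (mem_range.2 hi)]
      have : ∑ j ∈ (range w).erase i, min (x j) 1 ≤ ∑ j ∈ (range w).erase i, x j :=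
        sum_le_sum fun j _ => min_le_left _ _
      omega
    have h2 : ¬ conj (ofColumns w x) 0 ≤ a - 1 := fun h => by
      have := conj_ofColumns_le_iff.1 h i hi
      omega
    omega
  · exact isTail_ofColumns (by omega) (by omega) le_rfl (fun _ => h) (by omega)

theorem exists_isGood_isFat_of_long {a : ℕ} (hd : Antitone d) (hw : ∀ j, 0 < d j ↔ j < w)
    (h1 : 2 ≤ d 1) (h : a + 2 ≤ d 0 ∨ a + 2 ≤ w) :
    ∃ x y : ℕ → ℕ, (∀ j < w, x j + y j = d j) ∧ ∑ j ∈ range w, x j = a ∧ IsGood w x ∧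
      IsFat 2 w y := by
  have h10 : d 1 ≤ d 0 := hd zero_le_one
  have w1 : 1 < w := (hw 1).1 (by omega)
  have main : ∀ x : ℕ → ℕ, (∀ j < w, x j ≤ d j) → ∑ j ∈ range w, x j = a → IsGood w x →
      x 0 + 2 ≤ d 0 → x 1 + 2 ≤ d 1 → ∃ x y : ℕ → ℕ, (∀ j < w, x j + y j = d j) ∧
      ∑ j ∈ range w, x j = a ∧ IsGood w x ∧ IsFat 2 w y := by
    intro x hx hxs hxg hx0 hx1
    refine ⟨x, fun j => d j - x j, fun j hj => Nat.add_sub_cancel' (hx j hj), hxs, hxg,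
      (isFat_two_two (by omega) w1 zero_ne_one).mono fun j hj => ?_⟩
    simp only [Pi.add_apply, Pi.single_apply]
    split_ifs <;> subst_vars <;> omega
  rcases h with h | h
  · refine main (Pi.single 0 a) (fun j hj => ?_) (sum_single_eq (by omega) a)
      (Or.inr (Or.inl ⟨0, by omega, ?_⟩)) ?_ ?_
    · rw [Pi.single_apply]
      split_ifs <;> subst_vars <;> omega
    · rw [sum_single_eq (by omega), Pi.single_eq_same]
    · rw [Pi.single_eq_same]
      exact h
    · rw [Pi.single_eq_of_ne one_ne_zero]
      omega
  · have hu : w ≤ ∑ j ∈ range w, (if 2 ≤ j then 1 else 0) + 2 := by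
      have := sum_le_sum (s := range w) (f := fun _ => 1)
        (g := fun j => (if 2 ≤ j then 1 else 0) + (Pi.single 0 1 + Pi.single 1 1 : ℕ → ℕ) j)
        fun j _ => by
          simp only [Pi.add_apply, Pi.single_apply]
          split_ifs <;> omega
      have h0 := sum_single_le w 0 1
      have h1 := sum_single_le w 1 1
      simp only [Pi.add_apply, sum_add_distrib] at this
      simp only [sum_const, card_range, smul_eq_mul] at this
      omega
    obtain ⟨x, hx, hxs⟩ := exists_sum_eq (w := w) (l := fun _ => 0)
      (u := fun j => if 2 ≤ j then 1 else 0) (fun _ _ => Nat.zero_le _) (A := a) (by simp)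
      (by omega)
    have hx0 := (hx 0 (by omega)).2
    have hx1 := (hx 1 w1).2
    rw [if_neg (by omega)] at hx0 hx1
    refine main x (fun j hj => ?_) hxs (Or.inl fun j hj => ?_) (by omega) (by omega)
    · have := (hx j hj).2
      have := (hw j).2 hj
      split_ifs at * <;> omega
    · have := (hx j hj).2
      split_ifs at * <;> omega

theorem exists_isGood_isFat {a b : ℕ} (ha : 27 ≤ a) (hb : 27 ≤ b) (hd : Antitone d)
    (hw : ∀ j, 0 < d j ↔ j < w) (hD : a + b ≤ ∑ j ∈ range w, d j)
    (h : 2 ≤ d 1 ∨ 6 ≤ d 0 ∧ 5 ≤ w) :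
    ∃ x y : ℕ → ℕ, (∀ j < w, x j + y j = d j) ∧
      (∑ j ∈ range w, x j = a ∧ IsGood w x ∧ IsFat 2 w y ∨
        ∑ j ∈ range w, y j = b ∧ IsGood w y ∧ IsFat 2 w x) := by
  have d10 : d 1 ≤ d 0 := hd zero_le_one
  have d21 : d 2 ≤ d 1 := hd (by omega)
  have d32 : d 3 ≤ d 2 := hd (by omega)
  have core : ∀ lx ly : ℕ → ℕ, IsFat 2 w lx → IsFat 2 w ly → (∀ j < w, lx j + ly j ≤ d j) →
      ∑ j ∈ range w, lx j ≤ 5 → ∑ j ∈ range w, ly j ≤ 5 → ∃ x y : ℕ → ℕ,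
      (∀ j < w, x j + y j = d j) ∧ (∑ j ∈ range w, x j = a ∧ IsGood w x ∧ IsFat 2 w y ∨
        ∑ j ∈ range w, y j = b ∧ IsGood w y ∧ IsFat 2 w x) := by
    intro lx ly hlx hly hle hsx hsy
    obtain ⟨x, y, hxy, hx, hy, hxs, hys⟩ := exists_add_eq_of_add_le hle (A := a)
      (B := ∑ j ∈ range w, d j - a) (by omega) (by omega) (by omega)
    exact ⟨x, y, hxy, Or.inl ⟨hxs, Or.inr (Or.inr (hlx.mono hx)), hly.mono hy⟩⟩
  have sum2 : ∀ i j : ℕ, ∑ t ∈ range w, (Pi.single i 2 + Pi.single j 2 : ℕ → ℕ) t ≤ 5 := by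
    intro i j
    have := sum_single_le w i 2
    have := sum_single_le w j 2
    simp only [Pi.add_apply, sum_add_distrib]
    omega
  have sum3 : ∀ i j k : ℕ,
      ∑ t ∈ range w, (Pi.single i 3 + Pi.single j 1 + Pi.single k 1 : ℕ → ℕ) t ≤ 5 := by
    intro i j k
    have := sum_single_le w i 3
    have := sum_single_le w j 1
    have := sum_single_le w k 1
    simp only [Pi.add_apply, sum_add_distrib]
    omega
  have hook : 6 ≤ d 0 → 5 ≤ w → ∃ x y : ℕ → ℕ,
      (∀ j < w, x j + y j = d j) ∧ (∑ j ∈ range w, x j = a ∧ IsGood w x ∧ IsFat 2 w y ∨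
        ∑ j ∈ range w, y j = b ∧ IsGood w y ∧ IsFat 2 w x) := by
    intro h0 h5
    refine core _ _ (isFat_three_one_one (i := 0) (j := 1) (k := 2) (by omega) (by omega)
      (by omega) (by omega) (by omega)) (isFat_three_one_one (i := 0) (j := 3) (k := 4) (by omega)
      (by omega) (by omega) (by omega) (by omega)) (fun j hj => ?_) (sum3 _ _ _) (sum3 _ _ _)
    have := (hw j).2 hj
    simp only [Pi.add_apply, Pi.single_apply]
    split_ifs <;> subst_vars <;> omega
  rcases h with h | ⟨h0, h5⟩
  swap
  · exact hook h0 h5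
  by_cases hA : a + 2 ≤ d 0 ∨ a + 2 ≤ w
  · obtain ⟨x, y, hxy, hxs, hx, hy⟩ := exists_isGood_isFat_of_long hd hw h hA
    exact ⟨x, y, hxy, Or.inl ⟨hxs, hx, hy⟩⟩
  by_cases hB : b + 2 ≤ d 0 ∨ b + 2 ≤ w
  · obtain ⟨x, y, hxy, hxs, hx, hy⟩ := exists_isGood_isFat_of_long hd hw h hB
    exact ⟨y, x, fun j hj => by rw [add_comm, hxy j hj], Or.inr ⟨hxs, hx, hy⟩⟩
  have w1 := (hw 1).1
  have w2 := (hw 2).1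
  have w3 := (hw 3).1
  by_cases c1 : 4 ≤ d 1
  · refine core _ _ (isFat_two_two (i := 0) (j := 1) (by omega) (by omega) (by omega))
      (isFat_two_two (i := 0) (j := 1) (by omega) (by omega) (by omega)) (fun j hj => ?_)
      (sum2 _ _) (sum2 _ _)
    simp only [Pi.add_apply, Pi.single_apply]
    split_ifs <;> subst_vars <;> omega
  by_cases c2 : 2 ≤ d 3
  · refine core _ _ (isFat_two_two (i := 0) (j := 1) (by omega) (by omega) (by omega))
      (isFat_two_two (i := 2) (j := 3) (by omega) (by omega) (by omega)) (fun j hj => ?_)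
      (sum2 _ _) (sum2 _ _)
    simp only [Pi.add_apply, Pi.single_apply]
    split_ifs <;> subst_vars <;> omega
  by_cases c3 : 4 ≤ d 0 ∧ 2 ≤ d 2
  · refine core _ _ (isFat_two_two (i := 0) (j := 1) (by omega) (by omega) (by omega))
      (isFat_two_two (i := 0) (j := 2) (by omega) (by omega) (by omega)) (fun j hj => ?_)
      (sum2 _ _) (sum2 _ _)
    simp only [Pi.add_apply, Pi.single_apply]
    split_ifs <;> subst_vars <;> omega
  have hDle : ∑ j ∈ range w, d j ≤ w + (d 0 - 1) + (d 1 - 1) + (d 2 - 1) := by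
    have := sum_le_sum (s := range w) (f := d) (g := fun j => 1 + ((Pi.single 0 (d 0 - 1) : ℕ → ℕ) j
      + (Pi.single 1 (d 1 - 1) : ℕ → ℕ) j + (Pi.single 2 (d 2 - 1) : ℕ → ℕ) j)) fun j _ => by
        have : 3 ≤ j → d j ≤ d 3 := fun h => hd h
        simp only [Pi.single_apply]
        split_ifs <;> subst_vars <;> omega
    have h0 := sum_single_le w 0 (d 0 - 1)
    have h1 := sum_single_le w 1 (d 1 - 1)
    have h2 := sum_single_le w 2 (d 2 - 1)
    simp only [sum_add_distrib] at this
    simp only [sum_const, card_range, smul_eq_mul] at this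
    omega
  exact hook (by omega) (by omega)

theorem IsFat.of_le {m n : ℕ} (h : IsFat n w x) (hmn : m ≤ n) : IsFat m w x :=
  ⟨fun j hj => (Nat.add_le_add_left hmn _).trans (h.1 j hj),
    (Nat.add_le_add_left hmn _).trans h.2⟩

theorem lrPositive_of_add_eq_conj {ρ : ℕ → ℕ} (hρ : IsPartition ρ)
    (h : ∀ j < ρ 0, x j + y j = conj ρ j) :
    LRPositive ρ (ofColumns (ρ 0) x) (ofColumns (ρ 0) y) := by
  have key := LRPositive.ofColumns_add (ρ 0) x y
  rwa [ofColumns_congr (x := x + y) (y := conj ρ) h, hρ.ofColumns_conj_eq] at key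

theorem exists_isTail_of_conj_one_le {a b i : ℕ} {ρ : ℕ → ℕ} (ha : 27 ≤ a) (hb : 27 ≤ b)
    (hρ : IsPartition ρ) (hi : i ≤ 3) (hsize : psize ρ = a + b + i)
    (hrow : i = 1 → 2 ≤ ρ 0 ∧ 2 ≤ conj ρ 0) (h1 : conj ρ 1 ≤ 1)
    (h5 : conj ρ 0 ≤ 5 ∨ ρ 0 ≤ 4) :
    ∃ α β : ℕ → ℕ, IsTail a (2 * a) α ∧ IsTail b (2 * b - i) β ∧ LRPositive ρ α β := by
  obtain ⟨w, hw⟩ : ∃ w, ρ 0 = w := ⟨_, rfl⟩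
  obtain ⟨d, hdef⟩ : ∃ d, conj ρ = d := ⟨_, rfl⟩
  have hd : Antitone d := hdef ▸ hρ.isPartition_conj.1
  have hpos : ∀ j, 0 < d j ↔ j < w := fun j => by rw [← hdef, ← hw, hρ.lt_conj_iff]
  have hD : ∑ j ∈ range w, d j = a + b + i := by rw [← hsize, ← hρ.sum_conj, hw, hdef]
  rw [hw, hdef] at hrow
  rw [hdef] at h1
  rw [hw, hdef] at h5
  have hone : ∀ j, 1 ≤ j → d j ≤ 1 := fun j hj => (hd hj).trans h1
  have hDle : ∑ j ∈ range w, d j ≤ w + (d 0 - 1) := by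
    have := sum_le_sum (s := range w) (f := d)
      (g := fun j => 1 + (Pi.single 0 (d 0 - 1) : ℕ → ℕ) j) fun j _ => by
        have := hone j
        simp only [Pi.single_apply]
        split_ifs <;> subst_vars <;> omega
    have h0 := sum_single_le w 0 (d 0 - 1)
    simp only [sum_add_distrib] at this
    simp only [sum_const, card_range, smul_eq_mul] at this
    omega
  have hw0 : 0 < w := by
    rcases Nat.eq_zero_or_pos w with rfl | h
    · simp at hD
      omega
    · exact h
  have d0 : 0 < d 0 := (hpos 0).2 hw0
  have main : ∀ x : ℕ → ℕ, (∀ j < w, x j ≤ d j) → ∑ j ∈ range w, x j = a → IsGood w x →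
      (i = 0 → IsGood w fun j => d j - x j) → (i = 1 → IsFat 1 w fun j => d j - x j) →
      ∃ α β : ℕ → ℕ, IsTail a (2 * a) α ∧ IsTail b (2 * b - i) β ∧ LRPositive ρ α β := by
    intro x hx hxs hxg h0 h1
    have hadd : ∀ j < w, x j + (d j - x j) = d j := fun j hj => Nat.add_sub_cancel' (hx j hj)
    have hys : ∑ j ∈ range w, x j + ∑ j ∈ range w, (d j - x j) = ∑ j ∈ range w, d j := by
      rw [← sum_add_distrib]
      exact sum_congr rfl fun j hj => hadd j (mem_range.1 hj)
    refine ⟨ofColumns w x, ofColumns w fun j => d j - x j, hxg.isTail (by omega) hxs, ?_, ?_⟩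
    · rcases Nat.eq_zero_or_pos i with rfl | hpos
      · exact (h0 rfl).isTail (by omega) (by omega)
      · exact isTail_ofColumns (by omega) (by omega) (by omega) (by omega)
          fun h => h1 (by omega)
    · rw [← hw]
      exact lrPositive_of_add_eq_conj hρ (by rw [hw, hdef]; exact hadd)
  rcases h5 with h5 | h5
  · by_cases h2 : i = 0 ∧ d 0 ≤ 2
    · have hl := sum_single_le w 0 1
      obtain ⟨x, hx, hxs⟩ := exists_sum_eq (w := w) (l := Pi.single 0 1) (u := fun _ => 1)
        (fun j _ => by rw [Pi.single_apply]; split_ifs <;> omega) (A := a) (by omega)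
        (by simp; omega)
      have hx0 := (hx 0 hw0).1
      rw [Pi.single_eq_same] at hx0
      refine main x (fun j hj => ?_) hxs (Or.inl fun j hj => (hx j hj).2)
        (fun _ => Or.inl fun j hj => ?_) (by omega)
      · have := (hpos j).2 hj
        have := (hx j hj).2
        omega
      · dsimp only
        rcases Nat.eq_zero_or_pos j with rfl | hj0
        · omega
        · have := hone j hj0
          omega
    · have hu : w ≤ ∑ j ∈ range w, (if j = 0 ∨ w ≤ j + 2 then 0 else 1) + 3 := by
        have := sum_le_sum (s := range w) (f := fun _ => 1)
          (g := fun j => (if j = 0 ∨ w ≤ j + 2 then 0 else 1) + ((Pi.single 0 1 : ℕ → ℕ) j +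
            (Pi.single (w - 1) 1 : ℕ → ℕ) j + (Pi.single (w - 2) 1 : ℕ → ℕ) j))
          fun j hj => by
            rw [mem_range] at hj
            simp only [Pi.single_apply]
            split_ifs <;> omega
        have h0 := sum_single_le w 0 1
        have h1 := sum_single_le w (w - 1) 1
        have h2 := sum_single_le w (w - 2) 1
        simp only [sum_add_distrib] at this
        simp only [sum_const, card_range, smul_eq_mul] at this
        omega
      obtain ⟨x, hx, hxs⟩ := exists_sum_eq (w := w) (l := fun _ => 0)
        (u := fun j => if j = 0 ∨ w ≤ j + 2 then 0 else 1) (fun _ _ => Nat.zero_le _) (A := a)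
        (by simp) (by omega)
      refine main x (fun j hj => ?_) hxs (Or.inl fun j hj => ?_) (fun hi0 => ?_) fun hi1 => ?_
      · have := (hpos j).2 hj
        have := (hx j hj).2
        split_ifs at * <;> omega
      · have := (hx j hj).2
        split_ifs at * <;> omega
      · refine Or.inr (Or.inr ((isFat_three_one_one (i := 0) (j := w - 1) (k := w - 2) (by omega)
          (by omega) (by omega) (by omega) (by omega)).mono fun j hj => ?_))
        have := (hpos j).2 hj
        have := (hx j hj).2
        simp only [Pi.add_apply, Pi.single_apply]
        split_ifs at * <;> subst_vars <;> omega
      · refine (isFat_two_one (i := 0) (j := w - 1) (by omega)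
          (by omega) (by omega)).mono fun j hj => ?_
        have := hrow hi1
        have := (hpos j).2 hj
        have := (hx j hj).2
        simp only [Pi.add_apply, Pi.single_apply]
        split_ifs at * <;> subst_vars <;> omega
  · by_cases h2 : i = 0 ∧ w = 2
    · obtain ⟨rfl, rfl⟩ := h2
      have hd1 := (hpos 1).2 (by omega)
      simp only [sum_range_succ, sum_range_zero] at hD
      have hρeq : ρ = consPart (1 + 1) (column ((a - 1) + (b - 1))) := by
        funext t
        rcases t with _ | t
        · exact hw
        · have e0 := hρ.lt_conj_iff (i := t + 1) (j := 0)
          have e1 := hρ.conj_le_iff (i := t + 1) (j := 1)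
          rw [hdef] at e0 e1
          rw [consPart, if_neg (by omega), column]
          split_ifs <;> omega
      have hcol : ∀ n, 0 < n → consPart 1 (column (n - 1)) = column n := fun n hn => by
        funext t
        rcases t with _ | t <;> simp only [consPart, column] <;> split_ifs <;> omega
      refine ⟨column a, column b, isTail_column (by omega), isTail_column (by omega), ?_⟩
      rw [hρeq, ← hcol a (by omega), ← hcol b (by omega)]
      refine (LRPositive.column_add _ _).consPart ?_ ?_ ?_ <;> rw [column] <;> split_ifs <;> omega
    · refine main (Pi.single 0 a) (fun j hj => ?_) (sum_single_eq hw0 a)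
        (Or.inr (Or.inl ⟨0, hw0, by rw [sum_single_eq hw0, Pi.single_eq_same]⟩))
        (fun hi0 => ?_) fun hi1 => ?_
      · rw [Pi.single_apply]
        split_ifs <;> subst_vars <;> omega
      · by_cases hw1 : w = 1
        · subst hw1
          exact Or.inr (Or.inl ⟨0, hw0, by simp⟩)
        · refine Or.inr (Or.inr ((isFat_three_one_one (i := 0) (j := 1) (k := 2) (by omega)
            (by omega) (by omega) (by omega) (by omega)).mono fun j hj => ?_))
          have := (hpos j).2 hj
          simp only [Pi.add_apply, Pi.single_apply]
          split_ifs <;> subst_vars <;> omega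
      · have := hrow hi1
        refine (isFat_two_one (i := 0) (j := 1) (by omega)
          (by omega) (by omega)).mono fun j hj => ?_
        have := (hpos j).2 hj
        simp only [Pi.add_apply, Pi.single_apply]
        split_ifs <;> subst_vars <;> omega

theorem exists_isTail_split {a b p : ℕ} {ρ : ℕ → ℕ} (ha : 27 ≤ a) (hb : 27 ≤ b)
    (hρ : IsPartition ρ) (hsize : psize ρ + p = 3 * (a + b)) (hp : 3 * (a + b) + 2 ≤ 2 * p)
    (hp' : p ≤ 2 * (a + b)) (hrow : p + 1 = 2 * (a + b) → 2 ≤ ρ 0 ∧ 2 ≤ conj ρ 0) :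
    ∃ s s' : ℕ, ∃ α β : ℕ → ℕ, s + s' = p ∧ IsTail a s α ∧ IsTail b s' β ∧
      LRPositive ρ α β := by
  have hD := hρ.sum_conj
  by_cases hA : p + 4 ≤ 2 * (a + b)
  · obtain ⟨s, hs⟩ : ∃ s, s = max ((3 * a + 1) / 2) (p - (2 * b - 2)) := ⟨_, rfl⟩
    obtain ⟨x, y, hxy, -, -, hxs, hys⟩ := exists_add_eq_of_add_le (w := ρ 0) (d := conj ρ)
      (lx := fun _ => 0) (ly := fun _ => 0) (fun _ _ => Nat.zero_le _) (A := 3 * a - s)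
      (B := 3 * b - (p - s)) (by simp) (by simp) (by omega)
    refine ⟨s, p - s, _, _, by omega,
      isTail_ofColumns (w := ρ 0) (x := x) (by omega) (by omega) (by omega) (by omega) (by omega),
      isTail_ofColumns (w := ρ 0) (x := y) (by omega) (by omega) (by omega) (by omega) (by omega),
      lrPositive_of_add_eq_conj hρ hxy⟩
  · by_cases hB : 2 ≤ conj ρ 1 ∨ 6 ≤ conj ρ 0 ∧ 5 ≤ ρ 0
    · obtain ⟨x, y, hxy, h⟩ := exists_isGood_isFat ha hb hρ.isPartition_conj.1
        (fun j => hρ.lt_conj_iff) (by omega) hB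
      have hsum : ∑ j ∈ range (ρ 0), x j + ∑ j ∈ range (ρ 0), y j = psize ρ := by
        rw [← sum_add_distrib, ← hD]
        exact sum_congr rfl fun j hj => hxy j (mem_range.1 hj)
      rcases h with ⟨hs, hg, hf⟩ | ⟨hs, hg, hf⟩
      · exact ⟨2 * a, p - 2 * a, _, _, by omega, hg.isTail (by omega) hs,
          isTail_ofColumns (by omega) (by omega) (by omega) (fun _ => hf)
            (fun _ => hf.of_le (by omega)), lrPositive_of_add_eq_conj hρ hxy⟩
      · exact ⟨p - 2 * b, 2 * b, _, _, by omega, isTail_ofColumns (by omega) (by omega) (by omega)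
          (fun _ => hf) (fun _ => hf.of_le (by omega)), hg.isTail (by omega) hs,
          lrPositive_of_add_eq_conj hρ hxy⟩
    · obtain ⟨α, β, hα, hβ, h⟩ := exists_isTail_of_conj_one_le (i := 2 * (a + b) - p) ha hb hρ
        (by omega) (by omega) (fun h => hrow (by omega)) (by omega) (by omega)
      exact ⟨_, _, α, β, by omega, hα, hβ, h⟩

end Split
/-! ### Partitions with neither a long row nor a long column -/

section Middle

open Finset

variable {c : ℕ → ℕ}

theorem sum_indicator_le (p r s : ℕ) :
    ∑ j ∈ range p, (if r ≤ j ∧ j < s then 1 else 0) ≤ s - r := by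
  rw [← card_filter, ← Nat.card_Ico]
  exact card_le_card fun j hj => mem_Ico.2 (mem_filter.1 hj).2

theorem mul_le_sum_of_antitone (hc : Antitone c) {n j p : ℕ} (hn : n ≤ j + 1) (hj : j < p) :
    n * c j ≤ ∑ i ∈ range p, c i :=
  calc n * c j = ∑ _i ∈ range n, c j := by simp
    _ ≤ ∑ i ∈ range n, c i := sum_le_sum fun i hi => hc (by rw [mem_range] at hi; omega)
    _ ≤ ∑ i ∈ range p, c i :=
      sum_le_sum_of_subset (range_subset_range.2 (by omega))

/-- Capping the columns of a partition at height `2a - 2`, and dropping those with indices in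
`[r, s)`, leaves at least `3a` cells. -/
theorem le_sum_capped {a p r s : ℕ} (ha : 27 ≤ a) (hc : Antitone c)
    (hpos : ∀ j < p, 0 < c j) (hK : 3 * a + 27 ≤ ∑ j ∈ range p, c j)
    (hc0 : 2 * c 0 ≤ ∑ j ∈ range p, c j) (hr : r ≤ s) (hs : s ≤ p)
    (h : r = s ∨ r + (p - s) = 2 * a - 2 ∧ 3 * a ≤ 2 * a - 2 + 2 * r ∧
      3 * a + 2 * (s - r) ≤ ∑ j ∈ range p, c j) (hp2 : 2 ≤ p) :
    3 * a ≤ ∑ j ∈ range p, (if j < r ∨ s ≤ j then min (c j) (2 * a - 2) else 0) := by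
  have hcount := sum_indicator_le p r s
  have hT : p ≤ ∑ j ∈ range p, (if j < r ∨ s ≤ j then 1 else 0) + (s - r) := by
    have := sum_le_sum (s := range p) (f := fun _ => 1) (g := fun j =>
      (if j < r ∨ s ≤ j then 1 else 0) + if r ≤ j ∧ j < s then 1 else 0) fun j _ => by
        split_ifs <;> omega
    rw [sum_add_distrib] at this
    simp only [sum_const, card_range, smul_eq_mul] at this
    omega
  by_cases h1 : 2 * a - 2 ≤ c 1
  · have := sum_le_sum (s := range p) (f := fun j => (Pi.single 0 (2 * a - 2) : ℕ → ℕ) j +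
      (Pi.single 1 (2 * a - 2) : ℕ → ℕ) j)
      (g := fun j => if j < r ∨ s ≤ j then min (c j) (2 * a - 2) else 0) fun j _ => by
        have : c 1 ≤ c 0 := hc (by omega)
        simp only [Pi.single_apply]
        split_ifs <;> subst_vars <;> omega
    rw [sum_add_distrib, sum_single_eq (by omega), sum_single_eq (by omega)] at this
    omega
  by_cases h0 : 2 * a - 2 ≤ c 0
  · rcases h with rfl | h
    · have := sum_le_sum (s := range p) (f := c) (g := fun j =>
        (if j < r ∨ r ≤ j then min (c j) (2 * a - 2) else 0) +
          (Pi.single 0 (c 0 - (2 * a - 2)) : ℕ → ℕ) j) fun j _ => by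
          have : 1 ≤ j → c j ≤ c 1 := fun h => hc h
          simp only [Pi.single_apply]
          split_ifs <;> subst_vars <;> omega
      rw [sum_add_distrib, sum_single_eq (by omega)] at this
      omega
    · have := sum_le_sum (s := range p) (f := fun j => (if j < r ∨ s ≤ j then 1 else 0) +
          (Pi.single 0 (2 * a - 3) : ℕ → ℕ) j)
        (g := fun j => if j < r ∨ s ≤ j then min (c j) (2 * a - 2) else 0) fun j hj => by
          have := hpos j (mem_range.1 hj)
          simp only [Pi.single_apply]
          split_ifs <;> subst_vars <;> omega
      rw [sum_add_distrib, sum_single_eq (by omega)] at this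
      omega
  have hle : ∀ j, c j ≤ c 0 := fun j => hc (Nat.zero_le j)
  rcases h with rfl | h
  · have := sum_le_sum (s := range p) (f := c) (g := fun j =>
        (if j < r ∨ r ≤ j then min (c j) (2 * a - 2) else 0)) fun j _ => by
          have := hle j
          split_ifs <;> omega
    omega
  by_cases h3 : 3 ≤ c r
  · have hr' := sum_indicator_le p r p
    have hR : p ≤ ∑ j ∈ range p, (if j < r then 1 else 0) + (p - r) := by
      have := sum_le_sum (s := range p) (f := fun _ => 1) (g := fun j =>
        (if j < r then 1 else 0) + if r ≤ j ∧ j < p then 1 else 0) fun j hj => by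
          rw [mem_range] at hj
          split_ifs <;> omega
      rw [sum_add_distrib] at this
      simp only [sum_const, card_range, smul_eq_mul] at this
      omega
    have := sum_le_sum (s := range p) (f := fun j => (if j < r ∨ s ≤ j then 1 else 0) +
        2 * if j < r then 1 else 0)
      (g := fun j => if j < r ∨ s ≤ j then min (c j) (2 * a - 2) else 0) fun j hj => by
        have := hpos j (mem_range.1 hj)
        have : j < r → c r ≤ c j := fun h => hc h.le
        split_ifs <;> omega
    rw [sum_add_distrib, ← mul_sum] at this
    omega
  · have := sum_le_sum (s := range p) (f := c) (g := fun j =>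
      (if j < r ∨ s ≤ j then min (c j) (2 * a - 2) else 0) +
        2 * if r ≤ j ∧ j < s then 1 else 0) fun j _ => by
        have := hle j
        have : r ≤ j → c j ≤ c r := fun h => hc h
        split_ifs <;> omega
    rw [sum_add_distrib, ← mul_sum] at this
    omega

theorem exists_lrPositive_of_two_mul_le {a b : ℕ} {f : ℕ → ℕ} (ha : 27 ≤ a) (hb : 27 ≤ b)
    (hf : IsPartition f) (hsize : psize f = 3 * (a + b)) (hrow : 2 * f 0 ≤ 3 * (a + b))
    (hcol : 2 * conj f 0 ≤ 3 * (a + b)) :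
    ∃ μ ν : ℕ → ℕ, (IsPartition μ ∧ psize μ = 3 * a ∧ μ 0 ≤ 2 * a - 2 ∧ conj μ 0 ≤ 2 * a - 2) ∧
      (IsPartition ν ∧ psize ν = 3 * b ∧ ν 0 ≤ 2 * b - 2 ∧ conj ν 0 ≤ 2 * b - 2) ∧
      LRPositive f μ ν := by
  obtain ⟨p, hp⟩ : ∃ p, f 0 = p := ⟨_, rfl⟩
  obtain ⟨c, hdef⟩ : ∃ c, conj f = c := ⟨_, rfl⟩
  have hc : Antitone c := hdef ▸ hf.isPartition_conj.1
  have hpos : ∀ j < p, 0 < c j := fun j hj => by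
    rw [← hdef, hf.lt_conj_iff, hp]
    exact hj
  have hK : ∑ j ∈ range p, c j = 3 * (a + b) := by rw [← hsize, ← hf.sum_conj, hp, hdef]
  rw [hp] at hrow
  rw [hdef] at hcol
  have hp2 : 2 ≤ p := by
    have := sum_le_card_nsmul (range p) c (c 0) fun j _ => hc (Nat.zero_le j)
    rw [card_range, smul_eq_mul, hK] at this
    by_contra hlt
    have : p * c 0 ≤ 1 * c 0 := Nat.mul_le_mul_right _ (by omega)
    omega
  obtain ⟨s, hs⟩ : ∃ s, s = min p (2 * a - 2) := ⟨_, rfl⟩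
  obtain ⟨r, hr⟩ : ∃ r, r = min p (2 * b - 2) - (p - s) := ⟨_, rfl⟩
  obtain ⟨hx, hhx⟩ : ∃ hx : ℕ → ℕ, ∀ j, hx j = if j < s then min (c j) (2 * a - 2) else 0 :=
    ⟨_, fun _ => rfl⟩
  obtain ⟨hy, hhy⟩ : ∃ hy : ℕ → ℕ, ∀ j, hy j =
    if j < r ∨ s ≤ j then min (c j) (2 * b - 2) else 0 := ⟨_, fun _ => rfl⟩
  have hxsum : 3 * a ≤ ∑ j ∈ range p, hx j := by
    have := le_sum_capped (r := s) (s := p) ha hc hpos (by omega) (by omega) (by omega) le_rfl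
      (by omega) hp2
    refine this.trans (sum_le_sum fun j hj => ?_)
    rw [mem_range] at hj
    rw [hhx]
    split_ifs <;> omega
  have hysum : 3 * b ≤ ∑ j ∈ range p, hy j := by
    have := le_sum_capped (r := r) (s := s) hb hc hpos (by omega) (by omega) (by omega) (by omega)
      (by omega) hp2
    exact this.trans (sum_le_sum fun j hj => by rw [hhy])
  have hcover : ∀ j < p, c j ≤ hx j + hy j := fun j hj => by
    have h0 : c j ≤ c 0 := hc (Nat.zero_le j)
    have hmul := fun n (hn : n ≤ j + 1) => mul_le_sum_of_antitone hc hn hj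
    have h24 := hmul 24
    have h53 := hmul 53
    rw [hhx, hhy]
    split_ifs <;> omega
  have hyc : ∀ j, hy j ≤ c j := fun j => by
    rw [hhy]
    split_ifs <;> omega
  have hdiff : ∑ j ∈ range p, (c j - hy j) + ∑ j ∈ range p, hy j = 3 * (a + b) := by
    rw [← sum_add_distrib, ← hK]
    exact sum_congr rfl fun j _ => Nat.sub_add_cancel (hyc j)
  obtain ⟨x, hxb, hxs⟩ := exists_sum_eq (w := p) (l := fun j => c j - hy j) (u := hx)
    (fun j hj => by have := hcover j hj; omega) (A := 3 * a) (by omega) hxsum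
  have hxc : ∀ j < p, x j ≤ c j := fun j hj => by
    have := (hxb j hj).2
    rw [hhx] at this
    split_ifs at this <;> omega
  have hadd : ∀ j < p, x j + (c j - x j) = c j := fun j hj => Nat.add_sub_cancel' (hxc j hj)
  have hys : 3 * a + ∑ j ∈ range p, (c j - x j) = 3 * (a + b) := by
    rw [← hxs, ← sum_add_distrib, ← hK]
    exact sum_congr rfl fun j hj => hadd j (mem_range.1 hj)
  refine ⟨ofColumns p x, ofColumns p fun j => c j - x j,
    ⟨isPartition_ofColumns _ _, by rw [psize_ofColumns, hxs], ?_, ?_⟩,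
    ⟨isPartition_ofColumns _ _, by rw [psize_ofColumns]; omega, ?_, ?_⟩, ?_⟩
  · rw [ofColumns_zero_eq]
    have h1 := sum_indicator_le p 0 s
    have h2 := sum_le_sum (s := range p) (f := fun j => min (x j) 1)
      (g := fun j => if 0 ≤ j ∧ j < s then 1 else 0) fun j hj => by
        have := (hxb j (mem_range.1 hj)).2
        rw [hhx] at this
        split_ifs at * <;> omega
    omega
  · refine conj_ofColumns_le_iff.2 fun j hj => ?_
    have := (hxb j hj).2
    rw [hhx] at this
    split_ifs at this <;> omega
  · rw [ofColumns_zero_eq]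
    have h1 := sum_indicator_le p 0 r
    have h2 := sum_indicator_le p s p
    have h3 := sum_le_sum (s := range p) (f := fun j => min (c j - x j) 1)
      (g := fun j => (if 0 ≤ j ∧ j < r then 1 else 0) + if s ≤ j ∧ j < p then 1 else 0)
      fun j hj => by
        rw [mem_range] at hj
        have h4 := (hxb j hj).1
        have h5 := hyc j
        rw [hhy] at h4 h5
        split_ifs at * <;> omega
    rw [sum_add_distrib] at h3
    omega
  · refine conj_ofColumns_le_iff.2 fun j hj => ?_
    have h4 := (hxb j hj).1
    have h5 := hyc j
    rw [hhy] at h4 h5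
    split_ifs at * <;> omega
  · have := lrPositive_of_add_eq_conj (x := x) (y := fun j => c j - x j) hf
      (by rw [hp, hdef]; exact hadd)
    rwa [hp] at this

end Middle
/-! ### Partitions with a long row or a long column -/

section Assembly

variable {f ρ : ℕ → ℕ}

theorem IsPartition.eq_column (hρ : IsPartition ρ) (h : ρ 0 ≤ 1) {n : ℕ} (hn : psize ρ = n) :
    ρ = column n := by
  have key : ρ = column (conj ρ 0) := by
    funext i
    have h1 := hρ.lt_conj_iff (i := i) (j := 0)
    have h2 : ρ i ≤ ρ 0 := hρ.1 (Nat.zero_le i)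
    rw [column]
    split_ifs <;> omega
  have hsize := psize_column (conj ρ 0)
  rw [← key, hn] at hsize
  rwa [← hsize] at key

theorem IsPartition.eq_consPart_zero (hρ : IsPartition ρ) (h : conj ρ 0 ≤ 1) {n : ℕ}
    (hn : psize ρ = n) : ρ = SylowBranching.consPart n 0 := by
  have key : ρ = SylowBranching.consPart (ρ 0) 0 := by
    funext i
    rcases i with _ | i
    · rfl
    · have h1 := hρ.conj_le_iff (i := i + 1) (j := 0)
      change ρ (i + 1) = 0
      omega
  have hsize := psize_consPart isPartition_zero (ρ 0)
  rw [← key, hn, psize_zero, add_zero] at hsize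
  rwa [← hsize] at key

variable {k h a b : ℕ}

theorem mem_starOp_of_lrPositive {A B : Set (ℕ → ℕ)} {μ ν : ℕ → ℕ} (hf : IsPartition f)
    (hμ : μ ∈ A) (hν : ν ∈ B) (hν' : IsPartition ν) (hLR : LRPositive f μ ν) : f ∈ starOp A B :=
  ⟨hf, μ, hμ, ν, hν, hLR.LRcoeff_pos hf hν'⟩

theorem consPart_mem_starOp (hk : 1 ≤ k) (hh : 1 ≤ h) (ha : a = 3 ^ (k - 1))
    (hb : b = 3 ^ (h - 1)) (ha27 : 27 ≤ a) (hb27 : 27 ≤ b) {p : ℕ} (hρ : IsPartition ρ)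
    (hρp : ρ 0 ≤ p) (hsize : psize ρ + p = 3 * (a + b)) (hp : 3 * (a + b) + 2 ≤ 2 * p)
    (hp' : p ≤ 2 * (a + b)) : consPart p ρ ∈ starOp (Cset k) (Cset h) := by
  have main : ∀ {s s' : ℕ} {α β : ℕ → ℕ}, IsTail a s α → IsTail b s' β →
      LRPositive (consPart p ρ) (consPart s α) (consPart s' β) →
      consPart p ρ ∈ starOp (Cset k) (Cset h) := fun hα hβ hLR =>
    mem_starOp_of_lrPositive (hρ.consPart hρp) (hα.consPart_mem_Cset hk ha (by omega))
      (hβ.consPart_mem_Cset hh hb (by omega)) (hβ.isPartition.consPart hβ.first_le) hLR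
  by_cases hrow : p + 1 = 2 * (a + b) → 2 ≤ ρ 0 ∧ 2 ≤ conj ρ 0
  · obtain ⟨s, s', α, β, rfl, hα, hβ, hLR⟩ :=
      exists_isTail_split ha27 hb27 hρ hsize hp hp' hrow
    exact main hα hβ (hLR.consPart hα.first_le hβ.first_le hρp)
  by_cases h0 : ρ 0 ≤ 1
  · refine main (isTail_column (by omega)) (isTail_column (by omega)) ?_
    have key := (LRPositive.column_add (a + 1) (b + 1)).add (LRPositive.of_add
      (isPartition_zero.consPart (Nat.zero_le (2 * a - 1))).1
      (isPartition_zero.consPart (Nat.zero_le (2 * b - 1))).1)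
    convert key using 1
    · rw [hρ.eq_column h0 (n := a + b + 1) (by omega)]
      funext i
      rcases i with _ | i <;> simp [consPart, column] <;> (try split_ifs) <;> omega
    · funext i
      rcases i with _ | i <;> simp [consPart, column]
      omega
    · funext i
      rcases i with _ | i <;> simp [consPart, column]
      omega
  · refine main (isTail_row (by omega)) (isTail_row (by omega)) ?_
    have key := (LRPositive.column_add 1 1).add (LRPositive.of_add
      ((isPartition_zero.consPart (Nat.zero_le a)).consPart (s := 2 * a - 1)
        (show a ≤ _ by omega)).1
      ((isPartition_zero.consPart (Nat.zero_le b)).consPart (s := 2 * b - 1)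
        (show b ≤ _ by omega)).1)
    convert key using 1
    · rw [hρ.eq_consPart_zero (n := a + b + 1) (by omega) (by omega)]
      funext i
      rcases i with _ | _ | i <;> simp [consPart, column] <;> omega
    · funext i
      rcases i with _ | _ | i <;> simp [consPart, column]
      omega
    · funext i
      rcases i with _ | _ | i <;> simp [consPart, column]
      omega

theorem column_add_mem_starOp (hk : 1 ≤ k) (hh : 1 ≤ h) (ha : a = 3 ^ (k - 1))
    (hb : b = 3 ^ (h - 1)) (ha27 : 27 ≤ a) (hb27 : 27 ≤ b) {p : ℕ} (hρ : IsPartition ρ)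
    (hsize : psize ρ + p = 3 * (a + b)) (hp : 3 * (a + b) + 2 ≤ 2 * p)
    (hp' : p ≤ 2 * (a + b)) : column p + ρ ∈ starOp (Cset k) (Cset h) := by
  have main : ∀ {s s' : ℕ} {α β : ℕ → ℕ}, IsTail a s α → IsTail b s' β →
      LRPositive (column p + ρ) (column s + α) (column s' + β) →
      column p + ρ ∈ starOp (Cset k) (Cset h) := fun hα hβ hLR =>
    mem_starOp_of_lrPositive (hρ.column_add p) (hα.column_add_mem_Cset hk ha (by omega))
      (hβ.column_add_mem_Cset hh hb (by omega)) (hβ.isPartition.column_add _) hLR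
  by_cases hrow : p + 1 = 2 * (a + b) → 2 ≤ ρ 0 ∧ 2 ≤ conj ρ 0
  · obtain ⟨s, s', α, β, rfl, hα, hβ, hLR⟩ :=
      exists_isTail_split ha27 hb27 hρ hsize hp hp' hrow
    exact main hα hβ ((LRPositive.column_add s s').add hLR)
  by_cases h0 : ρ 0 ≤ 1
  · refine main (isTail_column (by omega)) (isTail_column (by omega)) ?_
    rw [hρ.eq_column h0 (n := a + b + 1) (by omega),
      show p = 2 * a + 2 * b - 1 by omega]
    exact LRPositive.two_columns (by omega) (by omega)
  · refine main (isTail_row (by omega)) (isTail_row (by omega)) ?_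
    have key := (LRPositive.column_add (2 * a - 1) (2 * b - 1)).consPart (s := a + 1)
      (s' := b + 1) (by rw [column]; split_ifs <;> omega) (by rw [column]; split_ifs <;> omega)
      (by rw [column]; split_ifs <;> omega)
    convert key using 1
    · rw [hρ.eq_consPart_zero (n := a + b + 1) (by omega) (by omega)]
      funext i
      rcases i with _ | i <;> simp [consPart, column] <;> (try split_ifs) <;> omega
    · funext i
      rcases i with _ | i <;> simp [consPart, column] <;> (try split_ifs) <;> omega
    · funext i
      rcases i with _ | i <;> simp [consPart, column] <;> (try split_ifs) <;> omega

theorem Bset_subset_starOp (hk : 4 ≤ k) (hh : 4 ≤ h) (ha : a = 3 ^ (k - 1))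
    (hb : b = 3 ^ (h - 1)) :
    Bset (3 * (a + b)) (2 * (a + b)) ⊆ starOp (Cset k) (Cset h) := by
  rintro f ⟨⟨hf, hsize⟩, hrow, hcol⟩
  have ha27 : 27 ≤ a := ha ▸ Nat.pow_le_pow_right (n := 3) (by omega) (show 3 ≤ k - 1 by omega)
  have hb27 : 27 ≤ b := hb ▸ Nat.pow_le_pow_right (n := 3) (by omega) (show 3 ≤ h - 1 by omega)
  have heven : (a + b) % 2 = 0 := by
    have h1 : a % 2 = 1 := Nat.odd_iff.1 (ha ▸ Odd.pow (by decide))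
    have h2 : b % 2 = 1 := Nat.odd_iff.1 (hb ▸ Odd.pow (by decide))
    omega
  by_cases hwide : 3 * (a + b) < 2 * f 0
  · have hρ : IsPartition fun i => f (i + 1) := by
      obtain ⟨hanti, N, hN⟩ := hf
      exact ⟨fun i j hij => hanti (by omega), N, fun i hi => hN _ (by omega)⟩
    have hfeq : f = consPart (f 0) fun i => f (i + 1) := by
      funext i
      rcases i with _ | i <;> rfl
    have hs := psize_consPart hρ (f 0)
    rw [← hfeq] at hs
    rw [hfeq]
    exact consPart_mem_starOp (by omega) (by omega) ha hb ha27 hb27 hρ (hf.1 (by omega))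
      (by omega) (by omega) hrow
  by_cases htall : 3 * (a + b) < 2 * conj f 0
  · have hρ : IsPartition fun i => f i - 1 := by
      obtain ⟨hanti, N, hN⟩ := hf
      exact ⟨fun i j hij => Nat.sub_le_sub_right (hanti hij) 1, N, fun i hi => by simp [hN i hi]⟩
    have hfeq : f = column (conj f 0) + fun i => f i - 1 := by
      funext i
      have h1 := hf.lt_conj_iff (i := i) (j := 0)
      rw [Pi.add_apply, column]
      split_ifs <;> omega
    have hs := psize_column_add hρ (conj f 0)
    rw [← hfeq] at hs
    rw [hfeq]
    exact column_add_mem_starOp (by omega) (by omega) ha hb ha27 hb27 hρ (by omega) (by omega)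
      hcol
  obtain ⟨μ, ν, ⟨hμ, hμs, hμr, hμc⟩, ⟨hν, hνs, hνr, hνc⟩, hLR⟩ :=
    exists_lrPositive_of_two_mul_le ha27 hb27 hf hsize (by omega) (by omega)
  exact mem_starOp_of_lrPositive hf (mem_Cset_of_le (by omega) ha (by omega) hμ hμs hμr hμc)
    (mem_Cset_of_le (by omega) hb (by omega) hν hνs hνr hνc) hν hLR

end Assembly

/-- for `k, h ≥ 4`, with `a = 3^{k−1}`, `b = 3^{h−1}` and
`C_k = B_{3^k}(2a) ∖ {(2a, a−1, 1), (2a, 2, 1^{a−2}), (2a−1, a+1), (2a−1, 1^{a+1})}°`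
(and `C_h` analogously), one has `C_k ⋆ C_h = B_{3^k + 3^h}(2a + 2b)`. -/
theorem star_type5_type5 (k h : ℕ) (hk : 4 ≤ k) (hh : 4 ≤ h) :
    starOp (Cset k) (Cset h) =
      Bset (3 ^ k + 3 ^ h) (2 * 3 ^ (k - 1) + 2 * 3 ^ (h - 1)) := by
  apply Set.Subset.antisymm
  · rintro f ⟨hf, μ, hμ, ν, hν, hpos⟩
    exact starOp_Bset_subset _ _ _ _ ⟨hf, μ, hμ.1, ν, hν.1, hpos⟩
  · have hk3 : 3 ^ k = 3 * 3 ^ (k - 1) := by rw [← pow_succ', Nat.sub_add_cancel (by omega)]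
    have hh3 : 3 ^ h = 3 * 3 ^ (h - 1) := by rw [← pow_succ', Nat.sub_add_cancel (by omega)]
    rw [hk3, hh3, ← mul_add, ← mul_add]
    exact Bset_subset_starOp hk hh rfl rfl

end SylowBranching
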